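/- Let (X, ρ, 𝒞) be a semi-Cartan graph with GRS Δ, Weyl groupoid 𝒲, groupoid 𝒲̃, and nil-Hecke algebra 𝒩 over 𝕂 = ℤ[t_1,…,t_θ]. Then there exists a well-defined map Ψ : 𝒲̃ → End_ℤ(𝒩) such that for every expression of an element of 𝒲̃ as a word σ̃_{i_1}^x σ̃_{i_2} ⋯ σ̃_{i_m} in the generators, every f ∈ 𝕂 and every morphism w of 𝒲: Ψ(σ̃_{i_1}^x ⋯ σ̃_{i_m})(f T_w) = h_{i_1}^{x_1}(β_1) h_{i_2}^{x_2}(β_2) ⋯ h_{i_m}^{x_m}(β_m) · (s_{i_1}^{x_1} ⋯ s_{i_m}^{x_m} · f) T_w, where x_j := ρ_{i_{j−1}} ⋯ ρ_{i_1}(x) (so x_1 = x) and β_j := s_{i_1}^x ⋯ s_{i_{j−1}}(α_{i_j}); i.e. the right-hand side depends only on the element of 𝒲̃ represented by the word, and Ψ is multiplicative on composable elements. -/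

import Mathlib

open CategoryTheory

noncomputable section

namespace WeylGroupoid

variable {θ : ℕ} {X : Type} [Fintype X] [DecidableEq X]

/-- A *semi-Cartan graph*: a basic datum `(X, ρ)` together with a compatible bundle of
generalized Cartan matrices. -/
structure SCG (θ : ℕ) (X : Type) [Fintype X] [DecidableEq X] : Type where
  nonempty : Nonempty X
  /-- the involutions `ρ_i` of the basic datum -/
  ρ : Fin θ → X → X
  invol : ∀ i x, ρ i (ρ i x) = x
  /-- the bundle of generalized Cartan matrices `C^x` -/
  C : X → Fin θ → Fin θ → ℤ
  diag : ∀ x i, C x i i = 2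
  offdiag : ∀ x i j, i ≠ j → C x i j ≤ 0
  zero_iff : ∀ x i j, i ≠ j → (C x i j = 0 ↔ C x j i = 0)
  compat : ∀ x i j, C (ρ i x) i j = C x i j

/-- the simple root `α_i ∈ ℤ^θ` -/
def al (θ : ℕ) (i : Fin θ) : Fin θ → ℤ := Pi.single i 1

/-- the reflection `s_i^x` of `ℤ^θ`, `s_i^x (α_j) = α_j - c^x_{ij} α_i` -/
def srefl (G : SCG θ X) (x : X) (i : Fin θ) (v : Fin θ → ℤ) : Fin θ → ℤ :=
  fun k => v k - (if k = i then ∑ j, G.C x i j * v j else 0)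

/-- the cone `ℕ₀ α_i + ℕ₀ α_j` -/
def pairCone (θ : ℕ) (i j : Fin θ) : Set (Fin θ → ℤ) :=
  {v | ∃ a b : ℕ, v = (a : ℤ) • al θ i + (b : ℤ) • al θ j}

/-- A *generalized root system* on a semi-Cartan graph. -/
structure GRS (G : SCG θ X) : Type where
  /-- the root sets `Δ^x` -/
  Δ : X → Set (Fin θ → ℤ)
  pos_neg : ∀ x, Δ x = (Δ x ∩ {v | ∀ k, 0 ≤ v k}) ∪ (-(Δ x ∩ {v | ∀ k, 0 ≤ v k}))
  simple : ∀ x i, Δ x ∩ {v | ∃ c : ℤ, v = c • al θ i} = {al θ i, -al θ i}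
  reflect : ∀ x i, (srefl G x i) '' Δ x = Δ (G.ρ i x)
  pairFinite : ∀ x i j, (Δ x ∩ pairCone θ i j).Finite
  loop : ∀ x i j, (fun y => G.ρ i (G.ρ j y))^[(Δ x ∩ pairCone θ i j).ncard] x = x

variable (G : SCG θ X)

/-- The entries `m^x_{ij} = |Δ^x ∩ (ℕ₀α_i + ℕ₀α_j)|`. -/
def mnum (R : GRS G) (x : X) (i j : Fin θ) : ℕ := (R.Δ x ∩ pairCone θ i j).ncard

/-- the set of positive roots `Δ^x_+` -/
def posRoots (R : GRS G) (x : X) : Set (Fin θ → ℤ) := R.Δ x ∩ {v | ∀ k, 0 ≤ v k}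

/-- The objects of the Weyl groupoid (a type synonym for `X` carrying a quiver
structure depending on `G`). -/
def Obj (G : SCG θ X) : Type := X

instance : Quiver (Obj G) := ⟨fun a b => {i : Fin θ // G.ρ i (show X from b) = (show X from a)}⟩

/-- objects of the path category -/
def pob (x : X) : Paths (Obj G) := (x : X)

/-- the generating arrow `σ_i^x : ρ_i(x) → x` -/
def genArrow (x : X) (i : Fin θ) : pob G (G.ρ i x) ⟶ pob G x :=
  Quiver.Path.nil.cons (⟨i, rfl⟩ : (show Obj G from G.ρ i x) ⟶ (show Obj G from x))

/-- the source of the word `σ_{i_1}^x σ_{i_2} ⋯ σ_{i_m}` (with target `x`) -/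
def wsrc (G : SCG θ X) : List (Fin θ) → X → X
  | [], x => x
  | i :: l, x => wsrc G l (G.ρ i x)

/-- the path `σ_{i_1}^x σ_{i_2} ⋯ σ_{i_m} : wsrc(w,x) → x` in the free category -/
def pathOf (G : SCG θ X) : (w : List (Fin θ)) → (x : X) → (pob G (wsrc G w x) ⟶ pob G x)
  | [], _ => 𝟙 _
  | i :: l, x => (pathOf G l (G.ρ i x)) ≫ genArrow G x i


/-- transport a path along an equality of sources -/
def castSrc {a b c : X} (h : a = b) (f : pob G a ⟶ pob G c) : pob G b ⟶ pob G c := by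
  subst h; exact f

/-- the alternating word `[i, j, i, j, …]` of length `n` -/
def altWord (i j : Fin θ) : ℕ → List (Fin θ)
  | 0 => []
  | n + 1 => i :: altWord j i n

/-- The defining relations `(σ_i^x σ_j)^{m^x_{ij}} = id_x` of the Weyl groupoid. -/
inductive wrel (R : GRS G) : HomRel (Paths (Obj G))
  | rel (x : X) (i j : Fin θ)
      (h : wsrc G (altWord i j (2 * mnum G R x i j)) x = x) :
      wrel R (castSrc G h (pathOf G (altWord i j (2 * mnum G R x i j)) x))
        (𝟙 (pob G x))

variable (R : GRS G)

/-- The Weyl groupoid, as the quotient of the free category on the quiver of the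
`σ_i^x` by the relations `(σ_i^x σ_j)^{m^x_{ij}} = id_x` (every generator is invertible
in this quotient, so it is indeed a groupoid). -/
def W := CategoryTheory.Quotient (wrel G R)

instance : Category (W G R) := inferInstanceAs (Category (CategoryTheory.Quotient (wrel G R)))

/-- objects of the Weyl groupoid -/
def objW (x : X) : W G R := ⟨pob G x⟩

/-- hom-sets `𝒲(y, x)` of the Weyl groupoid -/
def homW (y x : X) := objW G R y ⟶ objW G R x

instance {y x : X} : CoeSort (homW G R y x) (objW G R y ⟶ objW G R x) := ⟨id⟩

/-- the morphism of the Weyl groupoid defined by the word `σ_{i_1}^x ⋯ σ_{i_m}` -/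
def morW (w : List (Fin θ)) (x : X) : homW G R (wsrc G w x) x :=
  (Quotient.functor (wrel G R)).map (pathOf G w x)

/-- the generator `σ_i^x : ρ_i(x) → x` in the Weyl groupoid -/
def genW (x : X) (i : Fin θ) : homW G R (G.ρ i x) x :=
  (Quotient.functor (wrel G R)).map (genArrow G x i)

/-- transport a morphism of the Weyl groupoid along an equality of sources -/
def castW {a b c : X} (h : a = b) (f : homW G R a c) : homW G R b c := by
  subst h; exact f

/-- transport a morphism of the Weyl groupoid along an equality of targets -/
def castTgt {a c c' : X} (h : c = c') (f : homW G R a c) : homW G R a c' := by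
  subst h; exact f

/-- the length `ℓ(f)` of a morphism of the Weyl groupoid -/
def len {y x : X} (f : homW G R y x) : ℕ :=
  sInf {n | ∃ w : List (Fin θ), w.length = n ∧
    ∃ h : wsrc G w x = y, castW G R h (morW G R w x) = f}

/-- `w` is a reduced expression of the morphism `f ∈ 𝒲(y,x)` -/
def IsRedEx (w : List (Fin θ)) {y x : X} (f : homW G R y x) : Prop :=
  ∃ h : wsrc G w x = y, castW G R h (morW G R w x) = f ∧ w.length = len G R f


section NilHecke

variable (𝕂 : Type) [CommRing 𝕂]

/-- the generator `e^x` of the free algebra -/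
def eF (x : X) : FreeAlgebra 𝕂 (X ⊕ X × Fin θ) := FreeAlgebra.ι 𝕂 (Sum.inl x)

/-- the generator `n_i^x` of the free algebra -/
def nF (x : X) (i : Fin θ) : FreeAlgebra 𝕂 (X ⊕ X × Fin θ) := FreeAlgebra.ι 𝕂 (Sum.inr (x, i))

/-- the word `n_{i_1}^x n_{i_2} ⋯ n_{i_m}` in the free algebra
(superscripts determined by composability) -/
def nWF (G : SCG θ X) (𝕂 : Type) [CommRing 𝕂] :
    List (Fin θ) → X → FreeAlgebra 𝕂 (X ⊕ X × Fin θ)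
  | [], _ => 1
  | i :: l, x => nF 𝕂 x i * nWF G 𝕂 l (G.ρ i x)

/-- The defining relations of the nil-Hecke algebra of `(X, ρ, 𝒞)`. -/
inductive nrel (R : GRS G) (𝕂 : Type) [CommRing 𝕂] :
    FreeAlgebra 𝕂 (X ⊕ X × Fin θ) → FreeAlgebra 𝕂 (X ⊕ X × Fin θ) → Prop
  | orth (x y : X) (h : x ≠ y) : nrel R 𝕂 (eF 𝕂 x * eF 𝕂 y) 0
  | idem (x : X) : nrel R 𝕂 (eF 𝕂 x * eF 𝕂 x) (eF 𝕂 x)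
  | total : nrel R 𝕂 (∑ x : X, eF 𝕂 x) 1
  | unit_right (x : X) (i : Fin θ) : nrel R 𝕂 (nF 𝕂 x i * eF 𝕂 (G.ρ i x)) (nF 𝕂 x i)
  | unit_left (x : X) (i : Fin θ) : nrel R 𝕂 (eF 𝕂 x * nF 𝕂 x i) (nF 𝕂 x i)
  | nil (x : X) (i : Fin θ) : nrel R 𝕂 (nF 𝕂 (G.ρ i x) i * nF 𝕂 x i) 0
  | braid (x : X) (i j : Fin θ) (hij : i ≠ j) :
      nrel R 𝕂 (nWF G 𝕂 (altWord i j (mnum G R x i j)) x)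
        (nWF G 𝕂 (altWord j i (mnum G R x i j)) x)

/-- The nil-Hecke algebra `𝒩(X, ρ, 𝒞)` of a Weyl groupoid over `𝕂`. -/
def NH := RingQuot (nrel G R 𝕂)

instance : Ring (NH G R 𝕂) := inferInstanceAs (Ring (RingQuot (nrel G R 𝕂)))
instance : Algebra 𝕂 (NH G R 𝕂) := inferInstanceAs (Algebra 𝕂 (RingQuot (nrel G R 𝕂)))

/-- the generator `e^x` of the nil-Hecke algebra -/
def eN (x : X) : NH G R 𝕂 := RingQuot.mkAlgHom 𝕂 (nrel G R 𝕂) (eF 𝕂 x)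

/-- the generator `n_i^x` of the nil-Hecke algebra -/
def nN (x : X) (i : Fin θ) : NH G R 𝕂 := RingQuot.mkAlgHom 𝕂 (nrel G R 𝕂) (nF 𝕂 x i)

/-- the word `n_{i_1}^x n_{i_2} ⋯ n_{i_m}` in the nil-Hecke algebra -/
def nW (w : List (Fin θ)) (x : X) : NH G R 𝕂 := RingQuot.mkAlgHom 𝕂 (nrel G R 𝕂) (nWF G 𝕂 w x)

/-- the set of morphisms of the Weyl groupoid -/
def Mor := Σ (y : X) (x : X), homW G R y x

/-- the free `𝕂`-module `𝕂𝒲` on the set of morphisms of the Weyl groupoid -/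
abbrev KW := Mor G R →₀ 𝕂

/-- the endomorphism `E^x` of `𝕂𝒲` -/
def Emap (x : X) : KW G R 𝕂 →ₗ[𝕂] KW G R 𝕂 :=
  Finsupp.lift (KW G R 𝕂) 𝕂 (Mor G R)
    (fun m => if m.2.1 = x then Finsupp.single m 1 else 0)

/-- the value of the endomorphism `L_i^x` of `𝕂𝒲` on a basis morphism -/
def Lval (x : X) (i : Fin θ) (m : Mor G R) : KW G R 𝕂 :=
  if h : m.2.1 = G.ρ i x then
    (let f' : homW G R m.1 x := castTgt G R h m.2.2 ≫ genW G R x i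
     if len G R m.2.2 < len G R f' then Finsupp.single ⟨m.1, x, f'⟩ 1 else 0)
  else 0

/-- the endomorphism `L_i^x` of `𝕂𝒲` -/
def Lmap (x : X) (i : Fin θ) : KW G R 𝕂 →ₗ[𝕂] KW G R 𝕂 :=
  Finsupp.lift (KW G R 𝕂) 𝕂 (Mor G R) (Lval G R 𝕂 x i)

end NilHecke

end WeylGroupoid


namespace WeylGroupoid

variable {θ : ℕ} {X : Type} [Fintype X] [DecidableEq X]

/-- The ring automorphism of `𝕂 = ℤ[t_1,…,t_θ]` induced by the reflection `s_i^x`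
(via the identification `α_i ↦ t_i`): `t_j ↦ t_j - c^x_{ij} t_i`. -/
def sAct (G : SCG θ X) (x : X) (i : Fin θ) :
    MvPolynomial (Fin θ) ℤ →+* MvPolynomial (Fin θ) ℤ :=
  (MvPolynomial.aeval fun j => MvPolynomial.X j - MvPolynomial.C (G.C x i j) * MvPolynomial.X i :
    MvPolynomial (Fin θ) ℤ →ₐ[ℤ] MvPolynomial (Fin θ) ℤ).toRingHom

/-- the linear polynomial attached to `v ∈ ℤ^θ` under `α_i ↦ t_i` -/
def lin {θ : ℕ} (v : Fin θ → ℤ) : MvPolynomial (Fin θ) ℤ := ∑ k, MvPolynomial.C (v k) * MvPolynomial.X k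

/-- `h_i^x(t) = e^x + t n_i^x` if `ρ_i(x) = x`, and `h_i^x(t) = t n_i^x` otherwise. -/
def hGen (G : SCG θ X) (R : GRS G) (x : X) (i : Fin θ) (t : MvPolynomial (Fin θ) ℤ) :
    NH G R (MvPolynomial (Fin θ) ℤ) :=
  if G.ρ i x = x then eN G R _ x + t • nN G R _ x i else t • nN G R _ x i

/-- The product `h_{i_1}^{x_1}(s·t_{i_1}) h_{i_2}^{x_2}((s∘s_{i_1}^{x_1})·t_{i_2}) ⋯`;
with `s = id` this is
`h_{i_1}^{x_1}(t_{i_1}) h_{i_2}^{x_2}(s_{i_1}^{x_1}·t_{i_2}) ⋯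
 h_{i_m}^{x_m}(s_{i_1}^{x_1}⋯s_{i_{m-1}}·t_{i_m})`,
where `x_{k+1} = ρ_{i_k}(x_k)`. -/
def hP (G : SCG θ X) (R : GRS G) :
    List (Fin θ) → X → (MvPolynomial (Fin θ) ℤ →+* MvPolynomial (Fin θ) ℤ) →
      NH G R (MvPolynomial (Fin θ) ℤ)
  | [], _, _ => 1
  | i :: l, x, s => hGen G R x i (s (MvPolynomial.X i)) * hP G R l (G.ρ i x) (s.comp (sAct G x i))

/-- the composite ring automorphism `s_{i_1}^{x_1} s_{i_2}^{x_2} ⋯ s_{i_m}^{x_m}` of `𝕂`,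
where `x_{k+1} = ρ_{i_k}(x_k)` -/
def sComp (G : SCG θ X) :
    List (Fin θ) → X → (MvPolynomial (Fin θ) ℤ →+* MvPolynomial (Fin θ) ℤ)
  | [], _ => RingHom.id _
  | i :: l, x => (sAct G x i).comp (sComp G l (G.ρ i x))

end WeylGroupoid

namespace WeylGroupoid

variable {θ : ℕ} {X : Type} [Fintype X] [DecidableEq X] (G : SCG θ X) (R : GRS G)

/-- The braid relations alone (the relations `σ̃_i^x σ̃_i^{ρ_i(x)} = id_x` are omitted),
defining the groupoid `𝒲̃` covering the Weyl groupoid. -/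
inductive trel : HomRel (Paths (Obj G))
  | braid (x : X) (i j : Fin θ) (hij : i ≠ j)
      (h : wsrc G (altWord j i (mnum G R x i j)) x =
        wsrc G (altWord i j (mnum G R x i j)) x) :
      trel (pathOf G (altWord i j (mnum G R x i j)) x)
        (castSrc G h (pathOf G (altWord j i (mnum G R x i j)) x))

/-- The groupoid `𝒲̃`: the quotient of the free category on the quiver of the `σ̃_i^x`
by the braid relations only. -/
def Wt := CategoryTheory.Quotient (trel G R)

instance : Category (Wt G R) := inferInstanceAs (Category (CategoryTheory.Quotient (trel G R)))

/-- objects of `𝒲̃` -/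
def objWt (x : X) : Wt G R := ⟨pob G x⟩

/-- hom-sets of `𝒲̃` -/
def homWt (y x : X) := objWt G R y ⟶ objWt G R x

/-- the morphism `σ̃_{i_1}^x ⋯ σ̃_{i_m}` of `𝒲̃` defined by a word -/
def morWt (w : List (Fin θ)) (x : X) : homWt G R (wsrc G w x) x :=
  (Quotient.functor (trel G R)).map (pathOf G w x)

end WeylGroupoid

namespace WeylGroupoid

section Roots

variable {θ : ℕ} {X : Type} [Fintype X] [DecidableEq X] (G : SCG θ X)

lemma srefl_apply_of_ne (x : X) {i k : Fin θ} (hk : k ≠ i) (v : Fin θ → ℤ) :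
    srefl G x i v k = v k := by
  simp [srefl, hk]

lemma sum_cartan_mul_srefl (x : X) (i : Fin θ) (v : Fin θ → ℤ) :
    ∑ j, G.C x i j * srefl G x i v j = -∑ j, G.C x i j * v j := by
  have : ∀ j, G.C x i j * srefl G x i v j =
      G.C x i j * v j - (if j = i then G.C x i j * ∑ l, G.C x i l * v l else 0) := by
    intro j
    simp only [srefl]
    split_ifs <;> ring
  rw [Finset.sum_congr rfl fun j _ => this j, Finset.sum_sub_distrib]
  simp only [Finset.sum_ite_eq', Finset.mem_univ, if_true, G.diag]
  ring

lemma srefl_srefl (x : X) (i : Fin θ) (v : Fin θ → ℤ) : srefl G x i (srefl G x i v) = v := by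
  funext k
  conv_lhs => rw [srefl]
  rw [sum_cartan_mul_srefl]
  simp only [srefl]
  split_ifs <;> ring

/-- The reflection `s_i^x` as a linear automorphism of `ℤ^θ`. -/
def reflEquiv (x : X) (i : Fin θ) : (Fin θ → ℤ) ≃ₗ[ℤ] (Fin θ → ℤ) :=
  LinearEquiv.ofInvolutive
    { toFun := srefl G x i
      map_add' := fun v w => by
        funext k
        simp only [srefl, Pi.add_apply, mul_add, Finset.sum_add_distrib]
        split_ifs <;> ring
      map_smul' := fun c v => by
        funext k
        have : ∑ j, G.C x i j * (c • v) j = c * ∑ j, G.C x i j * v j := by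
          rw [Finset.mul_sum]
          refine Finset.sum_congr rfl fun j _ => ?_
          simp only [Pi.smul_apply, smul_eq_mul]
          ring
        simp only [srefl, RingHom.id_apply]
        rw [this]
        simp only [Pi.smul_apply, smul_eq_mul, srefl]
        split_ifs <;> ring }
    (srefl_srefl G x i)

@[simp]
lemma reflEquiv_apply (x : X) (i : Fin θ) (v : Fin θ → ℤ) : reflEquiv G x i v = srefl G x i v :=
  rfl

lemma srefl_al (x : X) (i j : Fin θ) : srefl G x i (al θ j) = al θ j - G.C x i j • al θ i := by
  funext k
  simp [srefl, al, Pi.single_apply]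

lemma srefl_al_self (x : X) (i : Fin θ) : srefl G x i (al θ i) = -al θ i := by
  rw [srefl_al, G.diag]
  module

/-- The linear automorphism `s_{i_1}^{x_1} ⋯ s_{i_m}^{x_m}` of `ℤ^θ`. -/
def wordEquiv : List (Fin θ) → X → ((Fin θ → ℤ) ≃ₗ[ℤ] (Fin θ → ℤ))
  | [], _ => LinearEquiv.refl ℤ _
  | i :: l, x => (wordEquiv l (G.ρ i x)).trans (reflEquiv G x i)

lemma wordEquiv_cons (i : Fin θ) (l : List (Fin θ)) (x : X) (v : Fin θ → ℤ) :
    wordEquiv G (i :: l) x v = srefl G x i (wordEquiv G l (G.ρ i x) v) :=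
  rfl

lemma wordEquiv_concat (l : List (Fin θ)) (i : Fin θ) (x : X) (v : Fin θ → ℤ) :
    wordEquiv G (l ++ [i]) x v = wordEquiv G l x (srefl G (wsrc G l x) i v) := by
  induction l generalizing x with
  | nil => rfl
  | cons j l ih => rw [List.cons_append, wordEquiv_cons, ih]; rfl

lemma wsrc_concat (l : List (Fin θ)) (i : Fin θ) (x : X) :
    wsrc G (l ++ [i]) x = G.ρ i (wsrc G l x) := by
  induction l generalizing x with
  | nil => rfl
  | cons j l ih => exact ih _

lemma rho_injective (i : Fin θ) : Function.Injective (G.ρ i) :=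
  Function.LeftInverse.injective (G.invol i)

lemma wsrc_injective (l : List (Fin θ)) : Function.Injective (wsrc G l) := by
  induction l with
  | nil => exact fun _ _ h => h
  | cons j l ih => exact fun _ _ h => rho_injective G j (ih h)

/-- The letter at position `n` (counted from `0`) of the word `i, j, i, j, …`. -/
def altLetter (i j : Fin θ) (n : ℕ) : Fin θ := if n % 2 = 0 then i else j

lemma altLetter_succ (i j : Fin θ) (n : ℕ) : altLetter i j (n + 1) = altLetter j i n := by
  unfold altLetter
  split_ifs <;> first | rfl | omega

lemma altLetter_cases (i j : Fin θ) (n : ℕ) :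
    (altLetter i j n = i ∧ altLetter j i n = j) ∨ (altLetter i j n = j ∧ altLetter j i n = i) := by
  unfold altLetter
  split_ifs <;> simp

lemma altWord_succ (i j : Fin θ) (n : ℕ) : altWord i j (n + 1) = i :: altWord j i n := rfl

lemma altWord_concat (i j : Fin θ) (n : ℕ) :
    altWord i j (n + 1) = altWord i j n ++ [altLetter i j n] := by
  induction n generalizing i j with
  | zero => rfl
  | succ n ih => rw [altWord_succ, ih, altLetter_succ]; rfl

lemma wsrc_altWord_succ (i j : Fin θ) (n : ℕ) (x : X) :
    wsrc G (altWord i j (n + 1)) x = G.ρ (altLetter i j n) (wsrc G (altWord i j n) x) := by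
  rw [altWord_concat, wsrc_concat]

lemma wsrc_altWord_two_mul (i j : Fin θ) (n : ℕ) (x : X) :
    wsrc G (altWord j i (2 * n)) x = (fun y => G.ρ i (G.ρ j y))^[n] x := by
  induction n generalizing x with
  | zero => rfl
  | succ n ih =>
    rw [Function.iterate_succ_apply, ← ih]
    rfl

variable {G} (R : GRS G)

lemma nonneg_or_nonpos {x : X} {v : Fin θ → ℤ} (hv : v ∈ R.Δ x) :
    (∀ k, 0 ≤ v k) ∨ (∀ k, v k ≤ 0) := by
  rw [R.pos_neg x] at hv
  rcases hv with hv | hv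
  · exact Or.inl hv.2
  · refine Or.inr fun k => ?_
    have := hv.2 k
    simp only [Pi.neg_apply] at this
    omega

lemma al_mem_roots (x : X) (i : Fin θ) : al θ i ∈ R.Δ x := by
  have : al θ i ∈ R.Δ x ∩ {v | ∃ c : ℤ, v = c • al θ i} := by
    rw [R.simple x i]
    simp
  exact this.1

lemma srefl_mem_roots {x : X} (i : Fin θ) {v : Fin θ → ℤ} (hv : v ∈ R.Δ (G.ρ i x)) :
    srefl G x i v ∈ R.Δ x := by
  rw [← R.reflect x i] at hv
  obtain ⟨u, hu, rfl⟩ := hv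
  rwa [srefl_srefl]

lemma mem_roots_of_srefl {x : X} (i : Fin θ) {v : Fin θ → ℤ} (hv : srefl G x i v ∈ R.Δ x) :
    v ∈ R.Δ (G.ρ i x) := by
  rw [← R.reflect x i]
  exact ⟨_, hv, srefl_srefl G x i v⟩

lemma wordEquiv_mem_roots (l : List (Fin θ)) (x : X) {v : Fin θ → ℤ} :
    wordEquiv G l x v ∈ R.Δ x ↔ v ∈ R.Δ (wsrc G l x) := by
  induction l generalizing x with
  | nil => rfl
  | cons i l ih =>
    rw [wordEquiv_cons]
    exact ⟨fun h => (ih _).1 (mem_roots_of_srefl R i h), fun h => srefl_mem_roots R i ((ih _).2 h)⟩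

/-- The positive roots in the span of `α_i` and `α_j`. -/
def planeRoots (x : X) (i j : Fin θ) : Set (Fin θ → ℤ) := R.Δ x ∩ pairCone θ i j

lemma mem_pairCone {i j : Fin θ} {v : Fin θ → ℤ} (hij : i ≠ j) :
    v ∈ pairCone θ i j ↔ (∀ k, k ≠ i → k ≠ j → v k = 0) ∧ ∀ k, 0 ≤ v k := by
  constructor
  · rintro ⟨a, b, rfl⟩
    refine ⟨fun k hi hj => by simp [al, hi, hj], fun k => ?_⟩
    simp only [al, Pi.add_apply, Pi.smul_apply, Pi.single_apply, smul_eq_mul]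
    positivity
  · rintro ⟨h0, hp⟩
    refine ⟨(v i).toNat, (v j).toNat, funext fun k => ?_⟩
    rw [Int.toNat_of_nonneg (hp i), Int.toNat_of_nonneg (hp j)]
    by_cases hi : k = i
    · subst hi
      simp [al, hij]
    · by_cases hj : k = j
      · subst hj
        simp [al, hi]
      · simp [al, hi, hj, h0 k hi hj]

lemma pairCone_comm (i j : Fin θ) : pairCone θ i j = pairCone θ j i := by
  ext v
  constructor <;> rintro ⟨a, b, rfl⟩ <;> exact ⟨b, a, add_comm _ _⟩

lemma planeRoots_comm (x : X) (i j : Fin θ) : planeRoots R x i j = planeRoots R x j i := by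
  rw [planeRoots, pairCone_comm, planeRoots]

lemma mnum_comm (x : X) (i j : Fin θ) : mnum G R x i j = mnum G R x j i :=
  congrArg Set.ncard (planeRoots_comm R x i j)

lemma al_mem_planeRoots (x : X) (i j : Fin θ) : al θ i ∈ planeRoots R x i j :=
  ⟨al_mem_roots R x i, 1, 0, by simp⟩

lemma al_mem_planeRoots_right (x : X) (i j : Fin θ) : al θ j ∈ planeRoots R x i j :=
  ⟨al_mem_roots R x j, 0, 1, by simp⟩

lemma al_injective : Function.Injective (al θ) := fun i j h => by
  by_contra hij
  have := congrFun h i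
  simp [al, hij] at this

lemma neg_al_not_nonneg (i : Fin θ) : ¬ ∀ k, 0 ≤ (-al θ i) k := fun h => by
  have := h i
  simp [al] at this

/-- A simple reflection permutes the positive roots of a plane other than the simple root. -/
lemma srefl_mem_planeRoots {x : X} {i j : Fin θ} (hij : i ≠ j) {v : Fin θ → ℤ}
    (hv : v ∈ planeRoots R (G.ρ i x) i j) (hne : v ≠ al θ i) :
    srefl G x i v ∈ planeRoots R x i j := by
  have hmem := srefl_mem_roots R i hv.1
  obtain ⟨h0, hp⟩ := (mem_pairCone hij).1 hv.2
  refine ⟨hmem, (mem_pairCone hij).2 ⟨fun k hi hj => ?_, ?_⟩⟩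
  · rw [srefl_apply_of_ne G x hi, h0 k hi hj]
  · refine (nonneg_or_nonpos R hmem).resolve_right fun hn => hne ?_
    have hj : v j = 0 := by
      have := hn j
      rw [srefl_apply_of_ne G x hij.symm] at this
      exact le_antisymm this (hp j)
    have hvi : v = v i • al θ i := by
      funext k
      by_cases hi : k = i
      · subst hi
        simp [al]
      · by_cases hkj : k = j
        · subst hkj
          simp [al, hi, hj]
        · simp [al, hi, h0 k hi hkj]
    have hs : v ∈ R.Δ (G.ρ i x) ∩ {v | ∃ c : ℤ, v = c • al θ i} := ⟨hv.1, _, hvi⟩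
    rw [R.simple] at hs
    rcases hs with hs | hs
    · exact hs
    · exact absurd (hs ▸ hp) (neg_al_not_nonneg i)

lemma mnum_rho_le (x : X) {i j : Fin θ} (hij : i ≠ j) :
    mnum G R (G.ρ i x) i j ≤ mnum G R x i j := by
  classical
  refine Set.ncard_le_ncard_of_injOn (fun v => if v = al θ i then al θ i else srefl G x i v)
    (fun v hv => ?_) (fun v hv w hw h => ?_) (R.pairFinite x i j)
  · split_ifs with h
    · exact al_mem_planeRoots R x i j
    · exact srefl_mem_planeRoots R hij hv h
  · have key : ∀ u ∈ planeRoots R (G.ρ i x) i j, al θ i ≠ srefl G x i u := fun u hu h => by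
      have : u = -al θ i := by rw [← srefl_al_self G x i, h, srefl_srefl]
      exact neg_al_not_nonneg i (this ▸ ((mem_pairCone hij).1 hu.2).2)
    dsimp only at h
    split_ifs at h with h1 h2 h2
    · rw [h1, h2]
    · exact absurd h (key w hw)
    · exact absurd h.symm (key v hv)
    · exact (reflEquiv G x i).injective h

lemma mnum_rho (x : X) {i j : Fin θ} (hij : i ≠ j) :
    mnum G R (G.ρ i x) i j = mnum G R x i j := by
  refine le_antisymm (mnum_rho_le R x hij) ?_
  have := mnum_rho_le R (G.ρ i x) hij
  rwa [G.invol] at this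

lemma mnum_rho_right (x : X) {i j : Fin θ} (hij : i ≠ j) :
    mnum G R (G.ρ j x) i j = mnum G R x i j := by
  rw [mnum_comm, mnum_rho R x hij.symm, mnum_comm]

lemma two_le_mnum (x : X) {i j : Fin θ} (hij : i ≠ j) : 2 ≤ mnum G R x i j := by
  rw [← Set.ncard_pair (al_injective.ne hij)]
  refine Set.ncard_le_ncard ?_ (R.pairFinite x i j)
  rintro v (rfl | rfl)
  · exact al_mem_planeRoots R x i j
  · exact al_mem_planeRoots_right R x i j

/-- Both alternating walks of length `m` starting at `x` end at the same object. -/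
lemma wsrc_altWord_mnum (x : X) (i j : Fin θ) :
    wsrc G (altWord i j (mnum G R x i j)) x = wsrc G (altWord j i (mnum G R x i j)) x := by
  set m := mnum G R x i j with hm
  have hloop : wsrc G (altWord j i (2 * m)) x = x := by
    rw [wsrc_altWord_two_mul]
    exact R.loop x i j
  have key : ∀ k ≤ 2 * m, wsrc G (altWord i j k) x = wsrc G (altWord j i (2 * m - k)) x := by
    intro k
    induction k with
    | zero => exact fun _ => hloop.symm
    | succ k ih =>
      intro hk
      obtain ⟨n, hn⟩ : ∃ n, 2 * m - k = n + 1 := ⟨2 * m - k - 1, by omega⟩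
      have hletter : altLetter i j k = altLetter j i n := by
        unfold altLetter
        split_ifs <;> first | rfl | omega
      rw [wsrc_altWord_succ, ih (by omega), hn, wsrc_altWord_succ, hletter, G.invol]
      congr 2
      omega
  rw [key m (by omega)]
  congr 2
  omega

/-- The alternating walk of length `m` starting at `x` with the step `i` ends with a loop exactly
when `j` is a loop at `x`. -/
lemma wsrc_altWord_loop_iff (x : X) {i j : Fin θ} (hij : i ≠ j) {n : ℕ}
    (hn : mnum G R x i j = n + 1) :
    wsrc G (altWord i j (n + 1)) x = wsrc G (altWord i j n) x ↔ G.ρ j x = x := by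
  have h := wsrc_altWord_mnum R (G.ρ j x) i j
  rw [mnum_rho_right R x hij, hn, altWord_succ j i] at h
  change _ = wsrc G (altWord i j n) (G.ρ j (G.ρ j x)) at h
  rw [G.invol] at h
  rw [← h]
  exact ⟨fun he => (wsrc_injective G _ he).symm, fun he => by rw [he]⟩

/-- The root `s_{i_1} ⋯ s_{i_n}(α_{i_{n+1}})` attached to the alternating word `i, j, i, …`. -/
def altRoot (G : SCG θ X) (i j : Fin θ) (x : X) (n : ℕ) : Fin θ → ℤ :=
  wordEquiv G (altWord i j n) x (al θ (altLetter i j n))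

@[simp]
lemma altRoot_zero (i j : Fin θ) (x : X) : altRoot G i j x 0 = al θ i := rfl

lemma altRoot_succ (i j : Fin θ) (x : X) (n : ℕ) :
    altRoot G i j x (n + 1) = srefl G x i (altRoot G j i (G.ρ i x) n) := by
  rw [altRoot, altWord_succ, wordEquiv_cons, altLetter_succ]
  rfl

lemma wordEquiv_altWord_al (i j : Fin θ) (x : X) (n : ℕ) :
    wordEquiv G (altWord i j (n + 1)) x (al θ (altLetter i j n)) = -altRoot G i j x n := by
  rw [altWord_concat, wordEquiv_concat, srefl_al_self, map_neg]
  rfl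

lemma altRoot_mem_roots (i j : Fin θ) (x : X) (n : ℕ) : altRoot G i j x n ∈ R.Δ x :=
  (wordEquiv_mem_roots R _ _).2 (al_mem_roots R _ _)

lemma wordEquiv_altWord_apply {i j k : Fin θ} (hi : k ≠ i) (hj : k ≠ j) (x : X) (n : ℕ)
    (v : Fin θ → ℤ) : wordEquiv G (altWord i j n) x v k = v k := by
  induction n generalizing i j x with
  | zero => rfl
  | succ n ih => rw [altWord_succ, wordEquiv_cons, srefl_apply_of_ne G x hi, ih hj hi]

lemma altRoot_apply {i j k : Fin θ} (hi : k ≠ i) (hj : k ≠ j) (x : X) (n : ℕ) :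
    altRoot G i j x n k = 0 := by
  rw [altRoot, wordEquiv_altWord_apply hi hj]
  rcases altLetter_cases i j n with h | h <;> simp [h.1, al, hi, hj]

lemma eq_smul_al_add {i j : Fin θ} (hij : i ≠ j) {v : Fin θ → ℤ}
    (hv : ∀ k, k ≠ i → k ≠ j → v k = 0) : v = v i • al θ i + v j • al θ j := by
  funext k
  by_cases hi : k = i
  · subst hi
    simp [al, hij]
  · by_cases hj : k = j
    · subst hj
      simp [al, hi]
    · simp [al, hi, hj, hv k hi hj]

lemma altRoot_mem_planeRoots (x : X) {i j : Fin θ} (hij : i ≠ j) {n : ℕ}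
    (hn : n < mnum G R x i j) : altRoot G i j x n ∈ planeRoots R x i j := by
  induction n using Nat.strong_induction_on with
  | _ n ih =>
    have hmem := altRoot_mem_roots R i j x n
    refine ⟨hmem, (mem_pairCone hij).2 ⟨fun k hi hj => altRoot_apply hi hj x n, ?_⟩⟩
    refine (nonneg_or_nonpos R hmem).resolve_right fun hneg => ?_
    rcases n with _ | n
    · have := hneg i
      simp [al] at this
    have hprev := ih n (by omega) (by omega)
    set w := wordEquiv G (altWord i j (n + 1)) x with hw
    have hpos := ((mem_pairCone hij).1 hprev.2).2
    have h1 : ∀ k, w (al θ (altLetter i j n)) k ≤ 0 := fun k => by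
      rw [hw, wordEquiv_altWord_al]
      simpa using hpos k
    have h2 : ∀ k, w (al θ (altLetter j i n)) k ≤ 0 := fun k => by
      rw [← altLetter_succ]
      exact hneg k
    have h3 : ∀ k, w (al θ i) k ≤ 0 ∧ w (al θ j) k ≤ 0 := fun k => by
      rcases altLetter_cases i j n with h | h
      · exact ⟨h.1 ▸ h1 k, h.2 ▸ h2 k⟩
      · exact ⟨h.2 ▸ h2 k, h.1 ▸ h1 k⟩
    have hcover : ∀ t ≤ n + 1, ∀ v ∈ planeRoots R x i j,
        v ∈ altRoot G i j x '' Set.Iio t ∨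
          ∀ k, 0 ≤ (wordEquiv G (altWord i j t) x).symm v k := by
      intro t
      induction t with
      | zero => exact fun _ v hv => Or.inr ((mem_pairCone hij).1 hv.2).2
      | succ t iht =>
        intro ht v hv
        rcases iht (by omega) v hv with h | h
        · exact Or.inl (Set.image_mono (Set.Iio_subset_Iio (Nat.le_succ t)) h)
        · set u := (wordEquiv G (altWord i j t) x).symm v with hu
          have hvu : v = wordEquiv G (altWord i j t) x u := by rw [hu, LinearEquiv.apply_symm_apply]
          by_cases hua : u = al θ (altLetter i j t)
          · exact Or.inl ⟨t, Nat.lt_succ_self t, by rw [hvu, hua]; rfl⟩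
          · right
            set z := wsrc G (altWord i j t) x with hz
            have hsymm : (wordEquiv G (altWord i j (t + 1)) x).symm v
                = srefl G z (altLetter i j t) u := by
              rw [LinearEquiv.symm_apply_eq, altWord_concat, wordEquiv_concat, srefl_srefl, ← hvu]
            have hus : u ∈ planeRoots R z i j := by
              refine ⟨(wordEquiv_mem_roots R _ _).1 (hvu ▸ hv.1), (mem_pairCone hij).2 ⟨?_, h⟩⟩
              intro k hi hj
              rw [← wordEquiv_altWord_apply (G := G) hi hj x t u, ← hvu]
              exact ((mem_pairCone hij).1 hv.2).1 k hi hj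
            rw [hsymm]
            have hCz : ∀ l u, srefl G z l u = srefl G (G.ρ l z) l u := fun l u => by
              funext k
              simp only [srefl, G.compat]
            rw [hCz]
            rcases altLetter_cases i j t with h' | h'
            · rw [h'.1] at hua ⊢
              refine ((mem_pairCone hij).1
                (srefl_mem_planeRoots R hij (x := G.ρ i z) ?_ hua).2).2
              rwa [G.invol]
            · rw [h'.1] at hua ⊢
              refine ((mem_pairCone hij.symm).1
                (srefl_mem_planeRoots R hij.symm (x := G.ρ j z) ?_ hua).2).2
              rwa [G.invol, planeRoots_comm]
    have hsub : planeRoots R x i j ⊆ altRoot G i j x '' Set.Iio (n + 1) := by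
      intro v hv
      refine (hcover (n + 1) le_rfl v hv).resolve_right fun h => ?_
      set u := w.symm v with hu
      have hvu : v = w u := by rw [hu, LinearEquiv.apply_symm_apply]
      have hu0 : ∀ k, k ≠ i → k ≠ j → u k = 0 := fun k hi hj => by
        rw [← wordEquiv_altWord_apply (G := G) hi hj x (n + 1) u, ← hw, ← hvu]
        exact ((mem_pairCone hij).1 hv.2).1 k hi hj
      have hv0 : v = 0 := by
        funext k
        refine le_antisymm ?_ (((mem_pairCone hij).1 hv.2).2 k)
        rw [hvu, eq_smul_al_add hij hu0, map_add, map_smul, map_smul]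
        simp only [Pi.add_apply, Pi.smul_apply, smul_eq_mul]
        simp only [Pi.zero_apply]
        nlinarith [mul_nonneg (h i) (neg_nonneg.2 (h3 k).1),
          mul_nonneg (h j) (neg_nonneg.2 (h3 k).2)]
      have h0 : (0 : Fin θ → ℤ) ∈ R.Δ x ∩ {v | ∃ c : ℤ, v = c • al θ i} :=
        ⟨hv0 ▸ hv.1, 0, by simp⟩
      rw [R.simple] at h0
      have hne : al θ i i = 1 := by simp [al]
      rcases h0 with h0 | h0
      · rw [← h0] at hne
        simp at hne
      · have := congrFun h0 i
        simp [al] at this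
    have hcard := Set.ncard_le_ncard hsub ((Set.finite_Iio _).image _)
    have hcard' := Set.ncard_image_le (f := altRoot G i j x) (Set.finite_Iio (n + 1))
    have hIio : (Set.Iio (n + 1)).ncard = n + 1 := by
      rw [← Finset.coe_Iio, Set.ncard_coe_finset, Nat.card_Iio]
    change mnum G R x i j ≤ _ at hcard
    omega

lemma altRoot_injOn (x : X) {i j : Fin θ} (hij : i ≠ j) {a b : ℕ} (hab : a < b)
    (hb : b < mnum G R x i j) : altRoot G i j x a ≠ altRoot G i j x b := by
  induction a generalizing b x i j with
  | zero =>
    obtain ⟨b, rfl⟩ : ∃ c, b = c + 1 := ⟨b - 1, by omega⟩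
    rw [altRoot_zero, altRoot_succ]
    intro h
    have hmem := altRoot_mem_planeRoots R (G.ρ i x) hij.symm (n := b)
      (by rw [mnum_comm, mnum_rho R x hij]; omega)
    have : altRoot G j i (G.ρ i x) b = -al θ i := by rw [← srefl_al_self G x i, h, srefl_srefl]
    exact neg_al_not_nonneg i (this ▸ ((mem_pairCone hij.symm).1 hmem.2).2)
  | succ a ih =>
    obtain ⟨b, rfl⟩ : ∃ c, b = c + 1 := ⟨b - 1, by omega⟩
    rw [altRoot_succ, altRoot_succ]
    intro h
    exact ih (G.ρ i x) hij.symm (b := b) (by omega)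
      (by rw [mnum_comm, mnum_rho R x hij]; omega) ((reflEquiv G x i).injective h)

lemma image_altRoot (x : X) {i j : Fin θ} (hij : i ≠ j) :
    altRoot G i j x '' (Finset.range (mnum G R x i j) : Set ℕ) = planeRoots R x i j := by
  refine Set.eq_of_subset_of_ncard_le ?_ ?_ (R.pairFinite x i j)
  · rintro _ ⟨n, hn, rfl⟩
    exact altRoot_mem_planeRoots R x hij (by simpa using hn)
  · rw [Set.InjOn.ncard_image, Set.ncard_coe_finset, Finset.card_range]
    · rfl
    · intro a ha b hb h
      simp only [Finset.coe_range, Set.mem_Iio] at ha hb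
      rcases lt_trichotomy a b with hab | hab | hab
      · exact absurd h (altRoot_injOn R x hij hab hb)
      · exact hab
      · exact absurd h.symm (altRoot_injOn R x hij hab ha)

/-- The last root of the alternating sequence starting with `α_i` is `α_j`. -/
lemma altRoot_last (x : X) {i j : Fin θ} (hij : i ≠ j) {n : ℕ} (hn : mnum G R x i j = n + 1) :
    altRoot G i j x n = al θ j := by
  have h := al_mem_planeRoots_right R x i j
  rw [← image_altRoot R x hij, hn] at h
  obtain ⟨k, hk, hkj⟩ := h
  simp only [Finset.coe_range, Set.mem_Iio] at hk
  rcases Nat.lt_succ_iff_lt_or_eq.1 hk with hlt | rfl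
  · exfalso
    have hmem := altRoot_mem_planeRoots R (G.ρ j x) hij.symm (n := k + 1)
      (by rw [mnum_comm, mnum_rho_right R x hij]; omega)
    rw [altRoot_succ, G.invol, hkj, srefl_al_self] at hmem
    exact neg_al_not_nonneg j ((mem_pairCone hij.symm).1 hmem.2).2
  · exact hkj

lemma wordEquiv_altWord_mnum (x : X) {i j : Fin θ} (hij : i ≠ j) {n : ℕ}
    (hn : mnum G R x i j = n + 1) :
    wordEquiv G (altWord i j (n + 1)) x (al θ (altLetter i j n)) = -al θ j ∧
      wordEquiv G (altWord i j (n + 1)) x (al θ (altLetter j i n)) = -al θ i := by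
  constructor
  · rw [wordEquiv_altWord_al, altRoot_last R x hij hn]
  · rw [← altLetter_succ]
    change altRoot G i j x (n + 1) = _
    rw [altRoot_succ, altRoot_last R (G.ρ i x) hij.symm (n := n), srefl_al_self]
    rw [mnum_comm, mnum_rho R x hij, hn]

/-- The reflections of a generalized root system satisfy the braid relations. -/
lemma wordEquiv_braid (x : X) {i j : Fin θ} (hij : i ≠ j) :
    wordEquiv G (altWord i j (mnum G R x i j)) x =
      wordEquiv G (altWord j i (mnum G R x i j)) x := by
  have hsrc := wsrc_altWord_mnum R x i j
  obtain ⟨n, hn⟩ : ∃ n, mnum G R x i j = n + 1 := by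
    have := two_le_mnum R x hij
    exact ⟨mnum G R x i j - 1, by omega⟩
  have hL := wordEquiv_altWord_mnum R x hij hn
  have hR := wordEquiv_altWord_mnum R x hij.symm (n := n) (by rw [mnum_comm, hn])
  rw [hn] at hsrc ⊢
  set w := wordEquiv G (altWord i j (n + 1)) x with hw
  set w' := wordEquiv G (altWord j i (n + 1)) x with hw'
  have hij' : w (al θ i) = w' (al θ i) ∧ w (al θ j) = w' (al θ j) := by
    rcases altLetter_cases i j n with h | h
    · rw [h.1, h.2] at hL hR
      exact ⟨hL.1.trans hR.2.symm, hL.2.trans hR.1.symm⟩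
    · rw [h.1, h.2] at hL hR
      exact ⟨hL.2.trans hR.1.symm, hL.1.trans hR.2.symm⟩
  have hal : ∀ l, w (al θ l) = w' (al θ l) := by
    intro l
    by_cases hi : l = i
    · rw [hi, hij'.1]
    by_cases hj : l = j
    · rw [hj, hij'.2]
    set p := w'.symm (w (al θ l)) - al θ l with hp
    have hp0 : ∀ k, k ≠ i → k ≠ j → p k = 0 := fun k hki hkj => by
      have h1 : w'.symm (w (al θ l)) k = w (al θ l) k := by
        conv_rhs => rw [← w'.apply_symm_apply (w (al θ l)), hw',
          wordEquiv_altWord_apply hkj hki]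
      rw [hp, Pi.sub_apply, h1, hw, wordEquiv_altWord_apply hki hkj, sub_self]
    have hpe := eq_smul_al_add hij hp0
    have hwp : w p = w' p := by
      rw [hpe, map_add, map_add, map_smul, map_smul, map_smul, map_smul, hij'.1, hij'.2]
    have hadd : w'.symm (w (al θ l)) = al θ l + p := by rw [hp]; abel
    have hwl : w (al θ l) = w' (al θ l) + w' p := by
      rw [← map_add, ← hadd, LinearEquiv.apply_symm_apply]
    have hsub : w.symm (w' (al θ l)) = al θ l - p := by
      rw [LinearEquiv.symm_apply_eq, map_sub, hwl, hwp, add_sub_cancel_right]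
    have hm1 : al θ l + p ∈ R.Δ (wsrc G (altWord j i (n + 1)) x) := by
      rw [← wordEquiv_mem_roots, ← hw', ← hadd, LinearEquiv.apply_symm_apply, hw,
        wordEquiv_mem_roots]
      exact al_mem_roots R _ l
    have hm2 : al θ l - p ∈ R.Δ (wsrc G (altWord i j (n + 1)) x) := by
      rw [← wordEquiv_mem_roots, ← hw, ← hsub, LinearEquiv.apply_symm_apply, hw',
        wordEquiv_mem_roots]
      exact al_mem_roots R _ l
    have hpl : p l = 0 := hp0 l hi hj
    have hpos1 := (nonneg_or_nonpos R hm1).resolve_right fun h => by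
      have := h l
      simp [al, hpl] at this
    have hpos2 := (nonneg_or_nonpos R hm2).resolve_right fun h => by
      have := h l
      simp [al, hpl] at this
    have hpz : p = 0 := by
      have hz : ∀ k, l ≠ k → p k = 0 := fun k hk => by
        have h1 := hpos1 k
        have h2 := hpos2 k
        simp only [al, Pi.add_apply, Pi.sub_apply, Pi.single_apply, if_neg (Ne.symm hk)] at h1 h2
        omega
      rw [hpe, hz i hi, hz j hj]
      simp
    rw [hwl, hpz, map_zero, add_zero]
  refine LinearEquiv.toLinearMap_injective (LinearMap.pi_ext' fun l => LinearMap.ext_ring ?_)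
  exact hal l

end Roots

end WeylGroupoid

namespace WeylGroupoid

section YangBaxter

variable {K A : Type*} [CommRing K] [Ring A] [Algebra K A] {e a b : A}

lemma yangBaxter_two (hab : a * b = b * a) (hea : e * a = a) (hae : a * e = a) (heb : e * b = b)
    (hbe : b * e = b) {t₁ t₂ u₁ u₂ : K} (h₁ : u₁ = t₂) (h₂ : u₂ = t₁) :
    (e + t₁ • a) * (e + t₂ • b) = (e + u₁ • b) * (e + u₂ • a) := by
  subst h₁ h₂
  simp only [mul_add, add_mul, smul_mul_assoc, mul_smul_comm, hea, hae, heb, hbe, hab]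
  module

lemma yangBaxter_three (hee : e * e = e) (hea : e * a = a) (hae : a * e = a) (heb : e * b = b)
    (hbe : b * e = b) (haa : a * a = 0) (hbb : b * b = 0)
    (hab : a * (b * a) = b * (a * b)) {t₁ t₂ t₃ u₁ u₂ u₃ : K}
    (ht₂ : t₂ = t₁ + t₃) (h₁ : u₁ = t₃) (h₂ : u₂ = t₂) (h₃ : u₃ = t₁) :
    (e + t₁ • a) * ((e + t₂ • b) * (e + t₃ • a)) =
      (e + u₁ • b) * ((e + u₂ • a) * (e + u₃ • b)) := by
  subst h₁ h₂ h₃ ht₂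
  have hea' : ∀ z, e * (a * z) = a * z := fun z => by rw [← mul_assoc, hea]
  have heb' : ∀ z, e * (b * z) = b * z := fun z => by rw [← mul_assoc, heb]
  simp only [mul_add, add_mul, smul_mul_assoc, mul_smul_comm, hee, hea, hae, heb, hbe, haa, hbb,
    hea', heb', hab, smul_zero, add_zero]
  module

lemma yangBaxter_four (hee : e * e = e) (hea : e * a = a) (hae : a * e = a) (heb : e * b = b)
    (hbe : b * e = b) (haa : a * a = 0) (hbb : b * b = 0)
    (hab : a * (b * (a * b)) = b * (a * (b * a)))
    {t₁ t₂ t₃ t₄ u₁ u₂ u₃ u₄ : K}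
    (ht₂ : t₂ = t₁ + t₄) (ht₃ : t₃ = t₁ + 2 * t₄)
    (h₁ : u₁ = t₄) (h₂ : u₂ = t₃) (h₃ : u₃ = t₂) (h₄ : u₄ = t₁) :
    (e + t₁ • a) * ((e + t₂ • b) * ((e + t₃ • a) * (e + t₄ • b))) =
      (e + u₁ • b) * ((e + u₂ • a) * ((e + u₃ • b) * (e + u₄ • a))) := by
  subst h₁ h₂ h₃ h₄ ht₂ ht₃
  have hea' : ∀ z, e * (a * z) = a * z := fun z => by rw [← mul_assoc, hea]
  have heb' : ∀ z, e * (b * z) = b * z := fun z => by rw [← mul_assoc, heb]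
  have haa' : ∀ z, a * (a * z) = 0 := fun z => by rw [← mul_assoc, haa, zero_mul]
  have hbb' : ∀ z, b * (b * z) = 0 := fun z => by rw [← mul_assoc, hbb, zero_mul]
  simp only [mul_add, add_mul, smul_mul_assoc, mul_smul_comm, hee, hea, hae, heb, hbe, haa, hbb,
    hea', heb', haa', hbb', hab, smul_zero, add_zero]
  module

lemma yangBaxter_six (hee : e * e = e) (hea : e * a = a) (hae : a * e = a) (heb : e * b = b)
    (hbe : b * e = b) (haa : a * a = 0) (hbb : b * b = 0)
    (hab : a * (b * (a * (b * (a * b)))) = b * (a * (b * (a * (b * a)))))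
    {t₁ t₂ t₃ t₄ t₅ t₆ u₁ u₂ u₃ u₄ u₅ u₆ : K}
    (ht₂ : t₂ = t₁ + t₆) (ht₃ : t₃ = 2 * t₁ + 3 * t₆) (ht₄ : t₄ = t₁ + 2 * t₆)
    (ht₅ : t₅ = t₁ + 3 * t₆)
    (h₁ : u₁ = t₆) (h₂ : u₂ = t₅) (h₃ : u₃ = t₄) (h₄ : u₄ = t₃) (h₅ : u₅ = t₂) (h₆ : u₆ = t₁) :
    (e + t₁ • a) * ((e + t₂ • b) * ((e + t₃ • a) * ((e + t₄ • b) *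
      ((e + t₅ • a) * (e + t₆ • b))))) =
      (e + u₁ • b) * ((e + u₂ • a) * ((e + u₃ • b) * ((e + u₄ • a) *
        ((e + u₅ • b) * (e + u₆ • a))))) := by
  subst h₁ h₂ h₃ h₄ h₅ h₆ ht₂ ht₃ ht₄ ht₅
  have hea' : ∀ z, e * (a * z) = a * z := fun z => by rw [← mul_assoc, hea]
  have heb' : ∀ z, e * (b * z) = b * z := fun z => by rw [← mul_assoc, heb]
  have haa' : ∀ z, a * (a * z) = 0 := fun z => by rw [← mul_assoc, haa, zero_mul]
  have hbb' : ∀ z, b * (b * z) = 0 := fun z => by rw [← mul_assoc, hbb, zero_mul]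
  simp only [mul_add, add_mul, smul_mul_assoc, mul_smul_comm, hee, hea, hae, heb, hbe, haa, hbb,
    hea', heb', haa', hbb', hab, smul_zero, add_zero]
  module

end YangBaxter

/-- Classification of the finite root sequences of rank two on a single object. -/
lemma rank_two_classification {u v : ℕ → ℤ} {a b : ℤ} {m : ℕ} (ha : 0 ≤ a) (hb : 0 ≤ b)
    (hab : a = 0 ↔ b = 0) (hm : 2 ≤ m) (u0 : u 0 = 1) (v0 : v 0 = 0) (u1 : u 1 = a) (v1 : v 1 = 1)
    (hv : ∀ n, v (n + 2) = b * u n - v n) (hu : ∀ n, u (n + 2) = a * v (n + 2) - u n)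
    (hpos : ∀ n < m, 0 ≤ u n) (hlast : ∀ n, m = n + 1 → u n = 0) :
    (a = 0 ∧ b = 0 ∧ m = 2) ∨ (a = 1 ∧ b = 1 ∧ m = 3) ∨ (a = 1 ∧ b = 2 ∧ m = 4) ∨
      (a = 1 ∧ b = 3 ∧ m = 6) ∨ (a = 2 ∧ b = 1 ∧ m = 4) ∨ (a = 3 ∧ b = 1 ∧ m = 6) := by
  have hlt : a * b < 4 := by
    by_contra! h4
    have hbp : 0 < b := by
      rcases hb.lt_or_eq with h | h
      · exact h
      · rw [← h] at h4
        omega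
    have step : ∀ n, (0 < u n ∧ 0 ≤ v n ∧ 2 * v n ≤ b * u n) →
        0 < u (n + 2) ∧ 0 ≤ v (n + 2) ∧ 2 * v (n + 2) ≤ b * u (n + 2) := by
      rintro n ⟨h1, h2, h3⟩
      have e1 := hv n
      have e2 := hu n
      have h2' : v n ≤ v (n + 2) := by linarith
      have h3' : 2 * v (n + 2) ≤ b * u (n + 2) := by
        rw [e2]
        nlinarith [mul_nonneg (sub_nonneg.2 h4) (h2.trans h2')]
      refine ⟨?_, h2.trans h2', h3'⟩
      have : 0 < v (n + 2) := by nlinarith [mul_pos hbp h1]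
      nlinarith
    have base1 : 0 < u 1 ∧ 0 ≤ v 1 ∧ 2 * v 1 ≤ b * u 1 := by
      rw [u1, v1]
      refine ⟨?_, by norm_num, by linarith⟩
      rcases ha.lt_or_eq with h | h
      · exact h
      · rw [← h] at h4
        omega
    have all : ∀ n, (0 < u n ∧ 0 ≤ v n ∧ 2 * v n ≤ b * u n) ∧
        (0 < u (n + 1) ∧ 0 ≤ v (n + 1) ∧ 2 * v (n + 1) ≤ b * u (n + 1)) := by
      intro n
      induction n with
      | zero => exact ⟨by rw [u0, v0]; exact ⟨by norm_num, le_rfl, by linarith⟩, base1⟩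
      | succ n ih => exact ⟨ih.2, step n ih.1⟩
    have h1 := hlast (m - 1) (by omega)
    have h2 := (all (m - 1)).1.1
    omega
  have V2 := hv 0
  have V3 := hv 1
  have V4 := hv 2
  have V5 := hv 3
  have V6 := hv 4
  have U2 := hu 0
  have U3 := hu 1
  have U4 := hu 2
  have U5 := hu 3
  have U6 := hu 4
  norm_num only at V2 V3 V4 V5 V6 U2 U3 U4 U5 U6
  rcases ha.lt_or_eq with ha' | ha'
  · have hb' : 0 < b := lt_of_le_of_ne hb fun h => ha'.ne' (hab.2 h.symm)
    have ha3 : a ≤ 3 := by nlinarith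
    have hb3 : b ≤ 3 := by nlinarith
    have hm6 : m ≤ 6 := by
      by_contra! h
      have P2 := hpos 2 (by omega)
      have P3 := hpos 3 (by omega)
      have P4 := hpos 4 (by omega)
      have P6 := hpos 6 (by omega)
      interval_cases a <;> interval_cases b <;> omega
    have P2 := hpos 2
    have P3 := hpos 3
    have P4 := hpos 4
    have P5 := hpos 5
    have hl := hlast (m - 1) (by omega)
    interval_cases a <;> interval_cases b <;> interval_cases m <;> norm_num only at hl <;> omega
  · have hb0 := hab.1 ha'.symm
    rw [← ha', u0, zero_mul] at U2
    have P2 := hpos 2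
    exact Or.inl ⟨ha'.symm, hb0, by omega⟩

end WeylGroupoid

namespace WeylGroupoid

section Coefficients

variable {θ : ℕ} {X : Type} [Fintype X] [DecidableEq X] (G : SCG θ X)

lemma lin_al (i : Fin θ) : lin (al θ i) = MvPolynomial.X i := by
  simp [lin, al, Pi.single_apply]

lemma sAct_X (x : X) (i j : Fin θ) : sAct G x i (MvPolynomial.X j) =
    MvPolynomial.X j - MvPolynomial.C (G.C x i j) * MvPolynomial.X i := by
  simp [sAct]

lemma sAct_lin (x : X) (i : Fin θ) (v : Fin θ → ℤ) :
    sAct G x i (lin v) = lin (srefl G x i v) := by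
  have hC : ∀ c : ℤ, sAct G x i (MvPolynomial.C c) = MvPolynomial.C c := fun c => by simp
  simp only [lin, srefl, map_sum, map_mul, hC, sAct_X, MvPolynomial.C_sub, sub_mul, mul_sub,
    Finset.sum_sub_distrib, apply_ite MvPolynomial.C, MvPolynomial.C_0, ite_mul, zero_mul,
    Finset.sum_ite_eq', Finset.mem_univ, if_true, Finset.sum_mul]
  congr 1
  exact Finset.sum_congr rfl fun j _ => by ring

lemma sComp_lin (w : List (Fin θ)) (x : X) (v : Fin θ → ℤ) :
    sComp G w x (lin v) = lin (wordEquiv G w x v) := by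
  induction w generalizing x with
  | nil => rfl
  | cons i w ih => rw [sComp, RingHom.comp_apply, ih, sAct_lin, wordEquiv_cons]

lemma sComp_X (w : List (Fin θ)) (x : X) (l : Fin θ) :
    sComp G w x (MvPolynomial.X l) = lin (wordEquiv G w x (al θ l)) := by
  rw [← sComp_lin, lin_al]

/-- The product of the roots `β_1 ⋯ β_m` attached to a word, twisted by `s`. -/
def rootProd : List (Fin θ) → X → (MvPolynomial (Fin θ) ℤ →+* MvPolynomial (Fin θ) ℤ) →
    MvPolynomial (Fin θ) ℤ
  | [], _, _ => 1
  | i :: l, x, s => s (MvPolynomial.X i) * rootProd l (G.ρ i x) (s.comp (sAct G x i))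

lemma rootProd_concat (w : List (Fin θ)) (k : Fin θ) (x : X)
    (s : MvPolynomial (Fin θ) ℤ →+* MvPolynomial (Fin θ) ℤ) :
    rootProd G (w ++ [k]) x s = rootProd G w x s * s (sComp G w x (MvPolynomial.X k)) := by
  induction w generalizing x s with
  | nil => simp [rootProd, sComp]
  | cons i w ih => rw [List.cons_append, rootProd, ih, ← mul_assoc]; rfl

lemma rootProd_altWord (i j : Fin θ) (n : ℕ) (x : X) :
    rootProd G (altWord i j n) x (RingHom.id _) =
      ∏ k ∈ Finset.range n, lin (altRoot G i j x k) := by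
  induction n with
  | zero => rfl
  | succ n ih =>
    rw [altWord_concat, rootProd_concat, ih, Finset.prod_range_succ, sComp_X]
    rfl

variable {G} (R : GRS G)

lemma sComp_braid (x : X) {i j : Fin θ} (hij : i ≠ j) :
    sComp G (altWord i j (mnum G R x i j)) x = sComp G (altWord j i (mnum G R x i j)) x :=
  MvPolynomial.ringHom_ext (fun c => by simp) fun l => by
    rw [sComp_X, sComp_X, wordEquiv_braid R x hij]

lemma rootProd_altWord_mnum (x : X) {i j : Fin θ} (hij : i ≠ j) :
    rootProd G (altWord i j (mnum G R x i j)) x (RingHom.id _) =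
      ∏ v ∈ (R.pairFinite x i j).toFinset, lin v := by
  classical
  rw [rootProd_altWord, ← Finset.prod_image (f := lin)]
  · congr 1
    ext v
    have := Set.ext_iff.1 (image_altRoot R x hij) v
    simpa [planeRoots] using this
  · intro a ha b hb h
    simp only [Finset.coe_range, Set.mem_Iio] at ha hb
    rcases lt_trichotomy a b with hab | hab | hab
    · exact absurd h (altRoot_injOn R x hij hab hb)
    · exact hab
    · exact absurd h.symm (altRoot_injOn R x hij hab ha)

lemma rootProd_braid (x : X) {i j : Fin θ} (hij : i ≠ j) :
    rootProd G (altWord i j (mnum G R x i j)) x (RingHom.id _) =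
      rootProd G (altWord j i (mnum G R x i j)) x (RingHom.id _) := by
  rw [rootProd_altWord_mnum R x hij, mnum_comm, rootProd_altWord_mnum R x hij.symm]
  refine Finset.prod_congr ?_ fun _ _ => rfl
  ext v
  simp [pairCone_comm i j]

/-- If `x` is a loop for `i`, dropping the first or the last letter of the longest alternating
word gives the same product of roots. -/
lemma rootProd_sAct (x : X) {i j : Fin θ} (hij : i ≠ j) (hi : G.ρ i x = x) {n : ℕ}
    (hn : mnum G R x i j = n + 1) :
    rootProd G (altWord j i n) x (sAct G x i) =
      rootProd G (altWord j i n) x (RingHom.id _) := by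
  have h := rootProd_braid R x hij
  have hlast : sComp G (altWord j i n) x (MvPolynomial.X (altLetter j i n)) =
      MvPolynomial.X i := by
    rw [sComp_X]
    exact (congrArg lin (altRoot_last R x hij.symm (by rw [mnum_comm, hn]))).trans (lin_al i)
  rw [hn, altWord_succ, altWord_concat, rootProd_concat, rootProd, hi, hlast, mul_comm,
    RingHom.id_apply] at h
  exact mul_right_cancel₀ (MvPolynomial.X_ne_zero i) h

end Coefficients

section NilHeckeRelations

variable {θ : ℕ} {X : Type} [Fintype X] [DecidableEq X] {G : SCG θ X} (R : GRS G)
  (𝕂 : Type) [CommRing 𝕂]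

/-- The projection of the free algebra onto the nil-Hecke algebra. -/
def toNH : FreeAlgebra 𝕂 (X ⊕ X × Fin θ) →ₐ[𝕂] NH G R 𝕂 := RingQuot.mkAlgHom 𝕂 (nrel G R 𝕂)

lemma toNH_surjective : Function.Surjective (toNH R 𝕂) := RingQuot.mkAlgHom_surjective 𝕂 _

lemma toNH_rel {a b : FreeAlgebra 𝕂 (X ⊕ X × Fin θ)} (h : nrel G R 𝕂 a b) :
    toNH R 𝕂 a = toNH R 𝕂 b := RingQuot.mkAlgHom_rel 𝕂 h

lemma eN_mul_self (x : X) : eN G R 𝕂 x * eN G R 𝕂 x = eN G R 𝕂 x :=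
  (map_mul (toNH R 𝕂) _ _).symm.trans (toNH_rel R 𝕂 (.idem x))

lemma eN_mul_eN {x y : X} (h : x ≠ y) : eN G R 𝕂 x * eN G R 𝕂 y = 0 :=
  (map_mul (toNH R 𝕂) _ _).symm.trans ((toNH_rel R 𝕂 (.orth x y h)).trans (map_zero _))

lemma sum_eN : ∑ x : X, eN G R 𝕂 x = 1 :=
  (map_sum (toNH R 𝕂) _ _).symm.trans ((toNH_rel R 𝕂 .total).trans (map_one _))

lemma nN_mul_eN (x : X) (i : Fin θ) : nN G R 𝕂 x i * eN G R 𝕂 (G.ρ i x) = nN G R 𝕂 x i :=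
  (map_mul (toNH R 𝕂) _ _).symm.trans (toNH_rel R 𝕂 (.unit_right x i))

lemma eN_mul_nN (x : X) (i : Fin θ) : eN G R 𝕂 x * nN G R 𝕂 x i = nN G R 𝕂 x i :=
  (map_mul (toNH R 𝕂) _ _).symm.trans (toNH_rel R 𝕂 (.unit_left x i))

lemma nN_mul_nN (x : X) (i : Fin θ) : nN G R 𝕂 (G.ρ i x) i * nN G R 𝕂 x i = 0 :=
  (map_mul (toNH R 𝕂) _ _).symm.trans ((toNH_rel R 𝕂 (.nil x i)).trans (map_zero _))

lemma nW_nil (x : X) : nW G R 𝕂 [] x = 1 := map_one (toNH R 𝕂)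

lemma nW_cons (i : Fin θ) (l : List (Fin θ)) (x : X) :
    nW G R 𝕂 (i :: l) x = nN G R 𝕂 x i * nW G R 𝕂 l (G.ρ i x) :=
  map_mul (toNH R 𝕂) _ _

lemma nW_braid (x : X) {i j : Fin θ} (hij : i ≠ j) :
    nW G R 𝕂 (altWord i j (mnum G R x i j)) x = nW G R 𝕂 (altWord j i (mnum G R x i j)) x :=
  toNH_rel R 𝕂 (.braid x i j hij)

end NilHeckeRelations

section Braid

variable {θ : ℕ} {X : Type} [Fintype X] [DecidableEq X] {G : SCG θ X} (R : GRS G)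

lemma hP_cons (i : Fin θ) (l : List (Fin θ)) (x : X)
    (s : MvPolynomial (Fin θ) ℤ →+* MvPolynomial (Fin θ) ℤ) :
    hP G R (i :: l) x s =
      hGen G R x i (s (MvPolynomial.X i)) * hP G R l (G.ρ i x) (s.comp (sAct G x i)) := rfl

lemma hGen_of_eq {x : X} {i : Fin θ} (h : G.ρ i x = x) (t : MvPolynomial (Fin θ) ℤ) :
    hGen G R x i t = eN G R _ x + t • nN G R _ x i := if_pos h

lemma hGen_of_ne {x : X} {i : Fin θ} (h : G.ρ i x ≠ x) (t : MvPolynomial (Fin θ) ℤ) :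
    hGen G R x i t = t • nN G R _ x i := if_neg h

/-- The terms of the expansion of `hP` on an alternating word of length `n + 1` which do not
vanish when at least one of the two letters is not a loop. -/
def leadingTerms (n : ℕ) (i j : Fin θ) (x : X)
    (s : MvPolynomial (Fin θ) ℤ →+* MvPolynomial (Fin θ) ℤ) : NH G R (MvPolynomial (Fin θ) ℤ) :=
  rootProd G (altWord i j (n + 1)) x s • nW G R _ (altWord i j (n + 1)) x +
    if wsrc G (altWord i j (n + 1)) x = wsrc G (altWord i j n) x then
      rootProd G (altWord i j n) x s • nW G R _ (altWord i j n) x else 0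

lemma leadingTerms_succ (n : ℕ) (i j : Fin θ) (x : X)
    (s : MvPolynomial (Fin θ) ℤ →+* MvPolynomial (Fin θ) ℤ) :
    leadingTerms R (n + 1) i j x s = s (MvPolynomial.X i) •
      (nN G R _ x i * leadingTerms R n j i (G.ρ i x) (s.comp (sAct G x i))) := by
  simp only [leadingTerms, altWord_succ _ _ (n + 1), altWord_succ i j n, wsrc, rootProd, nW_cons,
    mul_add, mul_ite, mul_zero, smul_add, mul_smul_comm, mul_smul]
  congr 1
  split_ifs <;> simp

lemma nN_mul_hP (n : ℕ) (i j : Fin θ) (z : X)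
    (s : MvPolynomial (Fin θ) ℤ →+* MvPolynomial (Fin θ) ℤ)
    (hz : ¬ (G.ρ i z = z ∧ G.ρ j z = z)) :
    nN G R _ (G.ρ j z) j * hP G R (altWord i j (n + 1)) z s =
      nN G R _ (G.ρ j z) j * leadingTerms R n i j z s := by
  induction n generalizing i j z s with
  | zero =>
    have he := nN_mul_eN R (MvPolynomial (Fin θ) ℤ) (G.ρ j z) j
    rw [G.invol] at he
    by_cases hi : G.ρ i z = z
    · simp [leadingTerms, altWord, wsrc, hP, rootProd, nW_cons, nW_nil, hGen_of_eq R hi, hi,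
        mul_add, he, add_comm]
    · simp [leadingTerms, altWord, wsrc, hP, rootProd, nW_cons, nW_nil, hGen_of_ne R hi, hi]
  | succ n ih =>
    have hz' : ¬ (G.ρ j (G.ρ i z) = G.ρ i z ∧ G.ρ i (G.ρ i z) = G.ρ i z) := by
      rintro ⟨h1, h2⟩
      rw [G.invol] at h2
      exact hz ⟨h2.symm, by rwa [← h2] at h1⟩
    have key := ih j i (G.ρ i z) (s.comp (sAct G z i)) hz'
    rw [G.invol] at key
    rw [altWord_succ, hP_cons, leadingTerms_succ, ← key]
    by_cases hi : G.ρ i z = z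
    · have hj : G.ρ j z ≠ z := fun hj => hz ⟨hi, hj⟩
      have h0 : nN G R _ (G.ρ j z) j * (eN G R _ z *
          hP G R (altWord j i (n + 1)) z (s.comp (sAct G z i))) = 0 := by
        have he := nN_mul_eN R (MvPolynomial (Fin θ) ℤ) (G.ρ j z) j
        rw [G.invol] at he
        rw [← mul_assoc, he, altWord_succ, hP_cons, hGen_of_ne R hj, ← mul_assoc, mul_smul_comm,
          nN_mul_nN, smul_zero, zero_mul]
      rw [hGen_of_eq R hi, hi, add_mul, mul_add, h0, zero_add, smul_mul_assoc]
    · rw [hGen_of_ne R hi, smul_mul_assoc]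

lemma hP_altWord_of_ne (n : ℕ) (i j : Fin θ) {x : X}
    (s : MvPolynomial (Fin θ) ℤ →+* MvPolynomial (Fin θ) ℤ) (hx : G.ρ i x ≠ x) :
    hP G R (altWord i j (n + 1)) x s = leadingTerms R n i j x s := by
  cases n with
  | zero => simp [leadingTerms, altWord, wsrc, hP, rootProd, nW_cons, nW_nil, hGen_of_ne R hx, hx]
  | succ n =>
    have h := nN_mul_hP R n j i (G.ρ i x) (s.comp (sAct G x i)) fun h => by
      rw [G.invol] at h
      exact hx h.2.symm
    rw [G.invol] at h
    rw [altWord_succ, hP_cons, hGen_of_ne R hx, smul_mul_assoc, h, leadingTerms_succ]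

lemma hP_braid_of_ne_of_ne (x : X) {i j : Fin θ} (hij : i ≠ j) (hi : G.ρ i x ≠ x)
    (hj : G.ρ j x ≠ x) :
    hP G R (altWord i j (mnum G R x i j)) x (RingHom.id _) =
      hP G R (altWord j i (mnum G R x i j)) x (RingHom.id _) := by
  have hr := rootProd_braid R x hij
  have hw := nW_braid R (MvPolynomial (Fin θ) ℤ) x hij
  obtain ⟨n, hn⟩ := Nat.exists_eq_add_of_le' (one_le_two.trans (two_le_mnum R x hij))
  have h1 := wsrc_altWord_loop_iff R x hij hn
  have h2 := wsrc_altWord_loop_iff R x hij.symm (by rw [mnum_comm, hn])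
  rw [hn] at hr hw ⊢
  rw [hP_altWord_of_ne R n i j _ hi, hP_altWord_of_ne R n j i _ hj, leadingTerms, leadingTerms,
    if_neg (h1.not.2 hj), if_neg (h2.not.2 hi), hr, hw]

lemma hP_braid_of_eq_of_ne (x : X) {i j : Fin θ} (hij : i ≠ j) (hi : G.ρ i x = x)
    (hj : G.ρ j x ≠ x) :
    hP G R (altWord i j (mnum G R x i j)) x (RingHom.id _) =
      hP G R (altWord j i (mnum G R x i j)) x (RingHom.id _) := by
  have hr := rootProd_braid R x hij
  have hw := nW_braid R (MvPolynomial (Fin θ) ℤ) x hij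
  obtain ⟨n, hn⟩ := Nat.exists_eq_add_of_le' (two_le_mnum R x hij)
  have h1 := wsrc_altWord_loop_iff R x hij hn
  have h2 := wsrc_altWord_loop_iff R x hij.symm (by rw [mnum_comm, hn])
  have hs := rootProd_sAct R x hij hi hn
  have hsucc := leadingTerms_succ R n i j x (RingHom.id _)
  have h3 : ¬ wsrc G (altWord j i (n + 1)) x = wsrc G (altWord j i n) x := by
    have h := h1.not.2 hj
    rwa [altWord_succ, altWord_succ i j n, wsrc, wsrc, hi] at h
  rw [hn] at hr hw ⊢
  rw [hi, RingHom.id_comp] at hsucc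
  rw [hP_altWord_of_ne R (n + 1) j i _ hj, altWord_succ, hP_cons, hGen_of_eq R hi, hi,
    RingHom.id_comp, hP_altWord_of_ne R n j i _ hj, add_mul, smul_mul_assoc, ← hsucc]
  rw [leadingTerms, leadingTerms, leadingTerms, if_neg h3, if_neg (h1.not.2 hj),
    if_pos (h2.2 hi), hr, hw, hs, add_zero, add_zero, add_comm, mul_smul_comm, altWord_succ j i n,
    nW_cons, ← mul_assoc, eN_mul_nN]

lemma rank_two_orbit_four {K : Type*} [CommRing K] {s r : K →+* K} {p q : K} (hsp : s p = -p)
    (hrq : r q = -q) (hsq : s q = q + p) (hrp : r p = p + 2 * q) :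
    s (r p) = p + 2 * q ∧ s (r (s q)) = q ∧ r (s q) = p + q ∧ r (s (r p)) = p := by
  have h1 : s (r p) = p + 2 * q := by
    rw [hrp, map_add, map_mul, map_ofNat, hsp, hsq]
    ring
  have h2 : r (s q) = p + q := by
    rw [hsq, map_add, hrp, hrq]
    ring
  refine ⟨h1, ?_, h2, ?_⟩
  · rw [h2, map_add, hsp, hsq]
    ring
  · rw [h1, map_add, map_mul, map_ofNat, hrp, hrq]
    ring

lemma rank_two_orbit_six {K : Type*} [CommRing K] {s r : K →+* K} {p q : K} (hsp : s p = -p)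
    (hrq : r q = -q) (hsq : s q = q + p) (hrp : r p = p + 3 * q) :
    s (r p) = 2 * p + 3 * q ∧ s (r (s q)) = p + 2 * q ∧ s (r (s (r p))) = p + 3 * q ∧
      s (r (s (r (s q)))) = q ∧ r (s q) = p + 2 * q ∧ r (s (r p)) = 2 * p + 3 * q ∧
      r (s (r (s q))) = p + q ∧ r (s (r (s (r p)))) = p := by
  have h1 : s (r p) = 2 * p + 3 * q := by
    rw [hrp, map_add, map_mul, map_ofNat, hsp, hsq]
    ring
  have h2 : r (s q) = p + 2 * q := by
    rw [hsq, map_add, hrp, hrq]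
    ring
  have h3 : s (r (s q)) = p + 2 * q := by
    rw [h2, map_add, map_mul, map_ofNat, hsp, hsq]
    ring
  have h4 : r (s (r p)) = 2 * p + 3 * q := by
    rw [h1, map_add, map_mul, map_mul, map_ofNat, map_ofNat, hrp, hrq]
    ring
  have h5 : s (r (s (r p))) = p + 3 * q := by
    rw [h4, map_add, map_mul, map_mul, map_ofNat, map_ofNat, hsp, hsq]
    ring
  have h6 : r (s (r (s q))) = p + q := by
    rw [h3, map_add, map_mul, map_ofNat, hrp, hrq]
    ring
  refine ⟨h1, h3, h5, ?_, h2, h4, h6, ?_⟩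
  · rw [h6, map_add, hsp, hsq]
    ring
  · rw [h5, map_add, map_mul, map_ofNat, hrp, hrq]
    ring

/-- The braid relation for `hP` on a single object with rank two Cartan entries
`(0, 0)`, `(-1, -1)`, `(-1, -2)` or `(-1, -3)`. -/
lemma hP_braid_of_cartan (x : X) {i j : Fin θ} (hij : i ≠ j) (hi : G.ρ i x = x)
    (hj : G.ρ j x = x)
    (h : (G.C x i j = 0 ∧ G.C x j i = 0 ∧ mnum G R x i j = 2) ∨
      (G.C x i j = -1 ∧ G.C x j i = -1 ∧ mnum G R x i j = 3) ∨
      (G.C x i j = -1 ∧ G.C x j i = -2 ∧ mnum G R x i j = 4) ∨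
      (G.C x i j = -1 ∧ G.C x j i = -3 ∧ mnum G R x i j = 6)) :
    hP G R (altWord i j (mnum G R x i j)) x (RingHom.id _) =
      hP G R (altWord j i (mnum G R x i j)) x (RingHom.id _) := by
  have hee := eN_mul_self R (MvPolynomial (Fin θ) ℤ) x
  have hea := eN_mul_nN R (MvPolynomial (Fin θ) ℤ) x i
  have heb := eN_mul_nN R (MvPolynomial (Fin θ) ℤ) x j
  have hae := nN_mul_eN R (MvPolynomial (Fin θ) ℤ) x i
  have hbe := nN_mul_eN R (MvPolynomial (Fin θ) ℤ) x j
  have haa := nN_mul_nN R (MvPolynomial (Fin θ) ℤ) x i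
  have hbb := nN_mul_nN R (MvPolynomial (Fin θ) ℤ) x j
  have hw := nW_braid R (MvPolynomial (Fin θ) ℤ) x hij
  rw [hi] at hae haa
  rw [hj] at hbe hbb
  have hsp : sAct G x i (MvPolynomial.X i) = -MvPolynomial.X i := by
    rw [sAct_X, G.diag, map_ofNat]
    ring
  have hrq : sAct G x j (MvPolynomial.X j) = -MvPolynomial.X j := by
    rw [sAct_X, G.diag, map_ofNat]
    ring
  have hsq := sAct_X G x i j
  have hrp := sAct_X G x j i
  rcases h with ⟨ha, hb, hm⟩ | ⟨ha, hb, hm⟩ | ⟨ha, hb, hm⟩ | ⟨ha, hb, hm⟩ <;> rw [hm] at hw ⊢ <;>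
    simp only [altWord, nW_cons, nW_nil, hi, hj, mul_one] at hw <;>
    simp only [altWord, hP, hGen_of_eq R hi, hGen_of_eq R hj, hi, hj, mul_one, RingHom.id_comp,
      RingHom.id_apply, RingHom.comp_apply] <;>
    rw [ha] at hsq <;> rw [hb] at hrp
  · rw [map_zero, zero_mul, sub_zero] at hsq hrp
    exact yangBaxter_two hw hea hae heb hbe hsq.symm hrp
  · rw [map_neg, map_one, neg_one_mul, sub_neg_eq_add] at hsq hrp
    have h1 : sAct G x i (sAct G x j (MvPolynomial.X i)) = MvPolynomial.X j := by
      rw [hrp, map_add, hsp, hsq]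
      ring
    have h2 : sAct G x j (sAct G x i (MvPolynomial.X j)) = MvPolynomial.X i := by
      rw [hsq, map_add, hrp, hrq]
      ring
    exact yangBaxter_three hee hea hae heb hbe haa hbb hw (by rw [h1, hsq, add_comm]) h1.symm
      (by rw [hsq, hrp, add_comm]) h2
  · rw [map_neg, map_one, neg_one_mul, sub_neg_eq_add] at hsq
    rw [map_neg, map_ofNat, neg_mul, sub_neg_eq_add] at hrp
    obtain ⟨h1, h2, h3, h4⟩ := rank_two_orbit_four hsp hrq hsq hrp
    exact yangBaxter_four hee hea hae heb hbe haa hbb hw (by rw [h2, hsq, add_comm])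
      (by rw [h1, h2]) h2.symm (by rw [h1, hrp]) (by rw [h3, hsq, add_comm]) h4
  · rw [map_neg, map_one, neg_one_mul, sub_neg_eq_add] at hsq
    rw [map_neg, map_ofNat, neg_mul, sub_neg_eq_add] at hrp
    obtain ⟨h1, h2, h3, h4, h5, h6, h7, h8⟩ := rank_two_orbit_six hsp hrq hsq hrp
    exact yangBaxter_six hee hea hae heb hbe haa hbb hw (by rw [h4, hsq, add_comm])
      (by rw [h1, h4]) (by rw [h4, h2]) (by rw [h3, h4]) h4.symm (by rw [h3, hrp])
      (h5.trans h2.symm) (h6.trans h1.symm) (by rw [h7, hsq, add_comm]) h8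

lemma hP_braid_of_eq_of_eq (x : X) {i j : Fin θ} (hij : i ≠ j) (hi : G.ρ i x = x)
    (hj : G.ρ j x = x) :
    hP G R (altWord i j (mnum G R x i j)) x (RingHom.id _) =
      hP G R (altWord j i (mnum G R x i j)) x (RingHom.id _) := by
  have hrec : ∀ n, altRoot G i j x (n + 2) = srefl G x i (srefl G x j (altRoot G i j x n)) := by
    intro n
    rw [altRoot_succ, altRoot_succ, hi, hj]
  have hval : ∀ n,
      altRoot G i j x n = altRoot G i j x n i • al θ i + altRoot G i j x n j • al θ j :=
    fun n => eq_smul_al_add hij fun k h1 h2 => altRoot_apply h1 h2 x n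
  have hrefl : ∀ k (c d : ℤ), srefl G x k (c • al θ i + d • al θ j) =
      c • srefl G x k (al θ i) + d • srefl G x k (al θ j) := fun k c d => by
    rw [← reflEquiv_apply, map_add, map_smul, map_smul]
    rfl
  have hstep : ∀ n, altRoot G i j x (n + 2) j =
        -G.C x j i * altRoot G i j x n i - altRoot G i j x n j ∧
      altRoot G i j x (n + 2) i = -G.C x i j * altRoot G i j x (n + 2) j - altRoot G i j x n i := by
    intro n
    have h := hrec n
    rw [hval n, hrefl, srefl_al_self, srefl_al] at h
    generalize altRoot G i j x n i = c at *
    generalize altRoot G i j x n j = d at *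
    have h' : altRoot G i j x (n + 2) =
        srefl G x i (c • al θ i + (-G.C x j i * c - d) • al θ j) := by
      rw [h]
      congr 1
      module
    rw [hrefl, srefl_al_self, srefl_al] at h'
    rw [h']
    constructor
    · simp [al, hij.symm]
    · simp [al, hij, hij.symm]
      ring
  have hone : altRoot G i j x 1 = al θ j - G.C x i j • al θ i := by
    rw [altRoot_succ, altRoot_zero, srefl_al]
  have hcl := rank_two_classification (u := fun n => altRoot G i j x n i)
    (v := fun n => altRoot G i j x n j) (a := -G.C x i j) (b := -G.C x j i)
    (m := mnum G R x i j) (neg_nonneg.2 (G.offdiag x i j hij))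
    (neg_nonneg.2 (G.offdiag x j i hij.symm)) (by simpa using G.zero_iff x i j hij)
    (two_le_mnum R x hij) (by simp [al]) (by simp [al, hij.symm])
    (by simp [hone, al, hij]) (by simp [hone, al, hij.symm])
    (fun n => (hstep n).1) (fun n => (hstep n).2)
    (fun n hn => ((mem_pairCone hij).1 (altRoot_mem_planeRoots R x hij hn).2).2 i)
    (fun n hn => by simp [altRoot_last R x hij hn, al, hij])
  by_cases hc : G.C x i j = 0 ∨ G.C x i j = -1
  · exact hP_braid_of_cartan R x hij hi hj (by omega)
  · have h := hP_braid_of_cartan R x hij.symm hj hi (by rw [mnum_comm]; omega)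
    rw [mnum_comm] at h
    exact h.symm

lemma hP_braid (x : X) {i j : Fin θ} (hij : i ≠ j) :
    hP G R (altWord i j (mnum G R x i j)) x (RingHom.id _) =
      hP G R (altWord j i (mnum G R x i j)) x (RingHom.id _) := by
  by_cases hi : G.ρ i x = x <;> by_cases hj : G.ρ j x = x
  · exact hP_braid_of_eq_of_eq R x hij hi hj
  · exact hP_braid_of_eq_of_ne R x hij hi hj
  · have h := hP_braid_of_eq_of_ne R x hij.symm hj hi
    rw [mnum_comm] at h
    exact h.symm
  · exact hP_braid_of_ne_of_ne R x hij hi hj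

end Braid

end WeylGroupoid

namespace WeylGroupoid

section Twist

variable {θ : ℕ} {X : Type} [Fintype X] [DecidableEq X] {G : SCG θ X} (R : GRS G)
  {𝕂 : Type} [CommRing 𝕂]

/-- The nil-Hecke algebra with scalars acting through the ring endomorphism `s`. -/
def TwistedNH (_ : 𝕂 →+* 𝕂) : Type := NH G R 𝕂

instance (s : 𝕂 →+* 𝕂) : Ring (TwistedNH R s) := inferInstanceAs (Ring (NH G R 𝕂))

instance (s : 𝕂 →+* 𝕂) : Algebra 𝕂 (TwistedNH R s) :=
  RingHom.toAlgebra' (S := NH G R 𝕂) ((algebraMap 𝕂 (NH G R 𝕂)).comp s)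
    fun c a => Algebra.commutes (s c) a

/-- The `s`-semilinear map on the free algebra fixing the generators. -/
def freeTwist (s : 𝕂 →+* 𝕂) : FreeAlgebra 𝕂 (X ⊕ X × Fin θ) →ₐ[𝕂] TwistedNH R s :=
  FreeAlgebra.lift 𝕂 (Sum.elim (eN G R 𝕂) fun p => nN G R 𝕂 p.1 p.2)

lemma freeTwist_eF (s : 𝕂 →+* 𝕂) (x : X) : freeTwist R s (eF 𝕂 x) = eN G R 𝕂 x :=
  FreeAlgebra.lift_ι_apply _ _

lemma freeTwist_nF (s : 𝕂 →+* 𝕂) (x : X) (i : Fin θ) :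
    freeTwist R s (nF 𝕂 x i) = nN G R 𝕂 x i :=
  FreeAlgebra.lift_ι_apply _ _

lemma freeTwist_nWF (s : 𝕂 →+* 𝕂) (l : List (Fin θ)) (x : X) :
    freeTwist R s (nWF G 𝕂 l x) = nW G R 𝕂 l x := by
  induction l generalizing x with
  | nil => exact (map_one (freeTwist R s)).trans (nW_nil R 𝕂 x).symm
  | cons i l ih =>
    rw [nWF, map_mul, freeTwist_nF, ih, nW_cons]
    rfl

lemma freeTwist_rel (s : 𝕂 →+* 𝕂) {a b : FreeAlgebra 𝕂 (X ⊕ X × Fin θ)} (h : nrel G R 𝕂 a b) :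
    freeTwist R s a = freeTwist R s b := by
  cases h with
  | orth x y h =>
    rw [map_mul, map_zero, freeTwist_eF, freeTwist_eF]
    exact eN_mul_eN R 𝕂 h
  | idem x =>
    rw [map_mul, freeTwist_eF]
    exact eN_mul_self R 𝕂 x
  | total =>
    rw [map_sum, map_one]
    exact (Finset.sum_congr rfl fun x _ => freeTwist_eF R s x).trans (sum_eN R 𝕂)
  | unit_right x i =>
    rw [map_mul, freeTwist_eF, freeTwist_nF]
    exact nN_mul_eN R 𝕂 x i
  | unit_left x i =>
    rw [map_mul, freeTwist_eF, freeTwist_nF]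
    exact eN_mul_nN R 𝕂 x i
  | nil x i =>
    rw [map_mul, map_zero, freeTwist_nF, freeTwist_nF]
    exact nN_mul_nN R 𝕂 x i
  | braid x i j hij =>
    rw [freeTwist_nWF, freeTwist_nWF]
    exact nW_braid R 𝕂 x hij

/-- The `s`-semilinear ring endomorphism of the nil-Hecke algebra fixing the generators. -/
def twist (s : 𝕂 →+* 𝕂) : NH G R 𝕂 →+* NH G R 𝕂 :=
  (RingQuot.liftAlgHom 𝕂 ⟨freeTwist R s, fun _ _ h => freeTwist_rel R s h⟩ :
    RingQuot (nrel G R 𝕂) →ₐ[𝕂] TwistedNH R s).toRingHom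

lemma twist_toNH (s : 𝕂 →+* 𝕂) (a : FreeAlgebra 𝕂 (X ⊕ X × Fin θ)) :
    twist R s (toNH R 𝕂 a) = freeTwist R s a :=
  RingQuot.liftAlgHom_mkAlgHom_apply (B := TwistedNH R s) 𝕂 (freeTwist R s)
    (fun _ _ h => freeTwist_rel R s h) a

lemma twist_eN (s : 𝕂 →+* 𝕂) (x : X) : twist R s (eN G R 𝕂 x) = eN G R 𝕂 x :=
  (twist_toNH R s _).trans (freeTwist_eF R s x)

lemma twist_nN (s : 𝕂 →+* 𝕂) (x : X) (i : Fin θ) : twist R s (nN G R 𝕂 x i) = nN G R 𝕂 x i :=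
  (twist_toNH R s _).trans (freeTwist_nF R s x i)

lemma twist_nW (s : 𝕂 →+* 𝕂) (l : List (Fin θ)) (x : X) :
    twist R s (nW G R 𝕂 l x) = nW G R 𝕂 l x :=
  (twist_toNH R s _).trans (freeTwist_nWF R s l x)

lemma twist_algebraMap (s : 𝕂 →+* 𝕂) (c : 𝕂) :
    twist R s (algebraMap 𝕂 (NH G R 𝕂) c) = algebraMap 𝕂 (NH G R 𝕂) (s c) := by
  have h := twist_toNH R s (algebraMap 𝕂 _ c)
  rw [AlgHom.commutes] at h
  exact h.trans ((freeTwist R s).commutes c)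

lemma twist_smul (s : 𝕂 →+* 𝕂) (c : 𝕂) (a : NH G R 𝕂) :
    twist R s (c • a) = s c • twist R s a := by
  rw [Algebra.smul_def, map_mul, twist_algebraMap, Algebra.smul_def]

lemma NH_ringHom_ext {φ ψ : NH G R 𝕂 →+* NH G R 𝕂}
    (hK : ∀ c : 𝕂, φ (algebraMap 𝕂 _ c) = ψ (algebraMap 𝕂 _ c))
    (he : ∀ x, φ (eN G R 𝕂 x) = ψ (eN G R 𝕂 x))
    (hn : ∀ x i, φ (nN G R 𝕂 x i) = ψ (nN G R 𝕂 x i)) (a : NH G R 𝕂) : φ a = ψ a := by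
  obtain ⟨a, rfl⟩ := toNH_surjective R 𝕂 a
  induction a using FreeAlgebra.induction with
  | grade0 c =>
    rw [AlgHom.commutes]
    exact hK c
  | grade1 y =>
    rcases y with x | ⟨x, i⟩
    · exact he x
    · exact hn x i
  | mul a b ha hb => rw [map_mul, map_mul, map_mul, ha, hb]
  | add a b ha hb => rw [map_add, map_add, map_add, ha, hb]

lemma twist_id (a : NH G R 𝕂) : twist R (RingHom.id 𝕂) a = a :=
  NH_ringHom_ext R (ψ := RingHom.id _) (fun _ => twist_algebraMap R _ _) (fun _ => twist_eN R _ _)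
    (fun _ _ => twist_nN R _ _ _) a

lemma twist_twist (s s' : 𝕂 →+* 𝕂) (a : NH G R 𝕂) :
    twist R s (twist R s' a) = twist R (s.comp s') a :=
  NH_ringHom_ext R (φ := (twist R s).comp (twist R s'))
    (fun c => by simp only [RingHom.comp_apply, twist_algebraMap])
    (fun x => by simp only [RingHom.comp_apply, twist_eN])
    (fun x i => by simp only [RingHom.comp_apply, twist_nN]) a

lemma twist_hGen (s : MvPolynomial (Fin θ) ℤ →+* MvPolynomial (Fin θ) ℤ) (x : X) (i : Fin θ)
    (t : MvPolynomial (Fin θ) ℤ) : twist R s (hGen G R x i t) = hGen G R x i (s t) := by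
  unfold hGen
  split_ifs <;> simp only [map_add, twist_smul, twist_eN, twist_nN]

lemma twist_hP (s s' : MvPolynomial (Fin θ) ℤ →+* MvPolynomial (Fin θ) ℤ) (l : List (Fin θ))
    (x : X) : twist R s (hP G R l x s') = hP G R l x (s.comp s') := by
  induction l generalizing x s' with
  | nil => exact map_one _
  | cons i l ih => rw [hP_cons, map_mul, twist_hGen, ih, hP_cons]; rfl

end Twist

section Words

variable {θ : ℕ} {X : Type} [Fintype X] [DecidableEq X] {G : SCG θ X} (R : GRS G)

lemma exists_castSrc_pathOf {y x : X} (p : pob G y ⟶ pob G x) :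
    ∃ (w : List (Fin θ)) (h : wsrc G w x = y), castSrc G h (pathOf G w x) = p := by
  change Quiver.Path (V := Obj G) y x at p
  induction p with
  | nil => exact ⟨[], rfl, rfl⟩
  | @cons b c p e ih =>
    obtain ⟨i, hi⟩ := e
    obtain rfl : G.ρ i c = b := hi
    obtain ⟨w, rfl, rfl⟩ := ih
    exact ⟨i :: w, rfl, rfl⟩

lemma exists_castW_morW {y x : X} (f : homW G R y x) :
    ∃ (w : List (Fin θ)) (h : wsrc G w x = y), castW G R h (morW G R w x) = f := by
  obtain ⟨p, rfl⟩ := (Quotient.functor (wrel G R)).map_surjective (X := pob G y) (Y := pob G x) f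
  obtain ⟨w, rfl, rfl⟩ := exists_castSrc_pathOf p
  exact ⟨w, rfl, rfl⟩

lemma exists_isRedEx {y x : X} (f : homW G R y x) : ∃ w, IsRedEx G R w f := by
  obtain ⟨w, h, hw⟩ := exists_castW_morW R f
  obtain ⟨w', hl, h', hw'⟩ := Nat.sInf_mem
    (s := {n | ∃ w : List (Fin θ), w.length = n ∧
      ∃ h : wsrc G w x = y, castW G R h (morW G R w x) = f}) ⟨_, w, rfl, h, hw⟩
  exact ⟨w', h', hw', hl⟩

end Words

section Representation

variable {θ : ℕ} {X : Type} [Fintype X] [DecidableEq X] {G : SCG θ X} (R : GRS G)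

/-- The action `a ↦ h_i^x(t_i) (s_i^x · a)` of the generator `σ̃_i^x`. -/
def generatorAction (x : X) (i : Fin θ) :
    NH G R (MvPolynomial (Fin θ) ℤ) →ₗ[ℤ] NH G R (MvPolynomial (Fin θ) ℤ) :=
  ((AddMonoidHom.mulLeft (hGen G R x i (MvPolynomial.X i))).comp
    (twist R (sAct G x i)).toAddMonoidHom).toIntLinearMap

lemma generatorAction_apply (x : X) (i : Fin θ) (a : NH G R (MvPolynomial (Fin θ) ℤ)) :
    generatorAction R x i a = hGen G R x i (MvPolynomial.X i) * twist R (sAct G x i) a := rfl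

/-- The action of the free category on the quiver of the `σ̃_i^x`. -/
def pathAction : Paths (Obj G) ⥤ ModuleCat ℤ :=
  Paths.lift
    { obj := fun _ => ModuleCat.of ℤ (NH G R (MvPolynomial (Fin θ) ℤ))
      map := fun {_ b} e => ModuleCat.ofHom (generatorAction R (show X from b) e.1) }

/-- The endomorphism by which a path acts. -/
def pathEnd {y x : X} (p : pob G y ⟶ pob G x) :
    NH G R (MvPolynomial (Fin θ) ℤ) →ₗ[ℤ] NH G R (MvPolynomial (Fin θ) ℤ) :=
  ((pathAction R).map p).hom

lemma pathEnd_castSrc {a b c : X} (h : a = b) (p : pob G a ⟶ pob G c) :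
    pathEnd R (castSrc G h p) = pathEnd R p := by
  subst h
  rfl

lemma pathEnd_comp {y z x : X} (p : pob G y ⟶ pob G z) (q : pob G z ⟶ pob G x) :
    pathEnd R (p ≫ q) = pathEnd R q ∘ₗ pathEnd R p :=
  congrArg ModuleCat.Hom.hom ((pathAction R).map_comp p q)

lemma pathEnd_genArrow (x : X) (i : Fin θ) :
    pathEnd R (genArrow G x i) = generatorAction R x i := rfl

lemma pathEnd_pathOf (w : List (Fin θ)) (x : X) (a : NH G R (MvPolynomial (Fin θ) ℤ)) :
    pathEnd R (pathOf G w x) a = hP G R w x (RingHom.id _) * twist R (sComp G w x) a := by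
  induction w generalizing x with
  | nil => exact ((one_mul _).trans (twist_id R a)).symm
  | cons i w ih =>
    change pathEnd R (pathOf G w (G.ρ i x) ≫ genArrow G x i) a = _
    rw [pathEnd_comp, LinearMap.comp_apply, ih, pathEnd_genArrow, generatorAction_apply, map_mul,
      twist_hP, twist_twist, hP_cons, mul_assoc]
    rfl

lemma pathAction_trel {a b : Paths (Obj G)} {p q : a ⟶ b} (h : trel G R p q) :
    (pathAction R).map p = (pathAction R).map q := by
  cases h with
  | braid x i j hij h =>
    have hpq (a : NH G R (MvPolynomial (Fin θ) ℤ)) :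
        pathEnd R (pathOf G (altWord i j (mnum G R x i j)) x) a =
          pathEnd R (castSrc G h (pathOf G (altWord j i (mnum G R x i j)) x)) a := by
      rw [pathEnd_castSrc, pathEnd_pathOf, pathEnd_pathOf, hP_braid R x hij, sComp_braid R x hij]
    exact ModuleCat.hom_ext (LinearMap.ext hpq)

/-- The functor from `𝒲̃` defined by the action on the nil-Hecke algebra. -/
def actionFunctor : Wt G R ⥤ ModuleCat ℤ :=
  CategoryTheory.Quotient.lift (trel G R) (pathAction R) fun _ _ _ _ h => pathAction_trel R h

end Representation

end WeylGroupoid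

namespace WeylGroupoid

/-- **The representation `Ψ` of `𝒲̃` on the nil-Hecke algebra (Theorem 4.7).**
There is a well-defined map `Ψ : 𝒲̃ → End_ℤ(𝒩)` such that for every word
`σ̃_{i_1}^x σ̃_{i_2} ⋯ σ̃_{i_m}`, every `f ∈ 𝕂 = ℤ[t_1,…,t_θ]` and every morphism `w`
of `𝒲`,
`Ψ(σ̃_{i_1}^x ⋯ σ̃_{i_m})(f T_w) = h_{i_1}^{x_1}(β_1) ⋯ h_{i_m}^{x_m}(β_m)
  (s_{i_1}^{x_1} ⋯ s_{i_m}^{x_m} · f) T_w`,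
where `x_j = ρ_{i_{j-1}} ⋯ ρ_{i_1}(x)` and `β_j = s_{i_1}^x ⋯ s_{i_{j-1}}(α_{i_j})`;
in particular the right-hand side only depends on the element of `𝒲̃` represented by
the word, and `Ψ` is multiplicative on composable elements. -/
theorem exists_Psi_representation {θ : ℕ} {X : Type} [Fintype X] [DecidableEq X]
    (G : SCG θ X) (R : GRS G)
    (T : ∀ y x : X, homW G R y x → NH G R (MvPolynomial (Fin θ) ℤ))
    (hT : ∀ (y x : X) (f : homW G R y x) (w : List (Fin θ)) (h : wsrc G w x = y),
      castW G R h (morW G R w x) = f → w.length = len G R f → 0 < w.length →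
      T y x f = nW G R (MvPolynomial (Fin θ) ℤ) w x)
    (hTid : ∀ x : X, T x x (𝟙 (objW G R x)) = eN G R (MvPolynomial (Fin θ) ℤ) x) :
    ∃ Ψ : ∀ y x : X, homWt G R y x →
        (NH G R (MvPolynomial (Fin θ) ℤ) →ₗ[ℤ] NH G R (MvPolynomial (Fin θ) ℤ)),
      (∀ (w : List (Fin θ)) (x : X) (f : MvPolynomial (Fin θ) ℤ)
          (y' x' : X) (v : homW G R y' x'),
        Ψ (wsrc G w x) x (morWt G R w x) (f • T y' x' v) =
          hP G R w x (RingHom.id _) * ((sComp G w x f) • T y' x' v)) ∧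
      (∀ (y z x : X) (p : homWt G R y z) (q : homWt G R z x),
        Ψ y x (p ≫ q) = (Ψ z x q) ∘ₗ (Ψ y z p)) := by
  have hTs : ∀ (s : MvPolynomial (Fin θ) ℤ →+* MvPolynomial (Fin θ) ℤ) (y x : X)
      (v : homW G R y x), twist R s (T y x v) = T y x v := by
    intro s y x v
    obtain ⟨w, h, hw, hl⟩ := exists_isRedEx R v
    rcases List.eq_nil_or_concat w with rfl | ⟨l, i, rfl⟩
    · subst h
      obtain rfl : 𝟙 (objW G R x) = v := by
        rw [← hw]
        exact ((Quotient.functor (wrel G R)).map_id (pob G x)).symm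
      exact (congrArg (twist R s) (hTid x)).trans ((twist_eN R s x).trans (hTid x).symm)
    · rw [hT y x v _ h hw hl (by simp), twist_nW]
  refine ⟨fun y x p => ((actionFunctor R).map p).hom, fun w x f y' x' v => ?_,
    fun y z x p q => congrArg ModuleCat.Hom.hom ((actionFunctor R).map_comp p q)⟩
  refine (pathEnd_pathOf R w x _).trans ?_
  rw [twist_smul, hTs]

end WeylGroupoid
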